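/- arXiv:1206.3152 — 3 statements merged into one kernel-verified Lean document; each statement's English description precedes it below -/
import Mathlib

section
/- For every real number α with 1 < α < 2 there exist constants c > 0 and d₀ such that for all integers d ≥ d₀, |F^E| ≤ (e + e^{−cd})·2^{2^{d−1}}. -/
/-- Two vertices of the Hamming cube `{0,1}^d` are adjacent iff they differ in
exactly one coordinate. -/
def cubeAdj (d : ℕ) (u v : Fin d → Bool) : Prop :=
  (Finset.univ.filter fun i => u i ≠ v i).card = 1


/-- The even vertices of the Hamming cube. -/
def evenV (d : ℕ) : Set (Fin d → Bool) :=
  {v | Even (Finset.univ.filter fun i => v i = true).card}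

/-- The odd vertices of the Hamming cube. -/
def oddV (d : ℕ) : Set (Fin d → Bool) :=
  {v | ¬ Even (Finset.univ.filter fun i => v i = true).card}


/-- Homomorphisms from \`Q_d\` to \`ℤ\` taking the value \`0\` on all but fewer than
\`α^d\` even vertices. -/
def FE (d : ℕ) (α : ℝ) : Set ((Fin d → Bool) → ℤ) :=
  {f | (∀ u v, cubeAdj d u v → |f u - f v| = 1) ∧
       (({v ∈ evenV d | f v ≠ 0} : Set _).ncard : ℝ) < α ^ d}

/-- Members of \`FE d α\` whose range has exactly \`i\` elements. -/
def FEi (d : ℕ) (α : ℝ) (i : ℕ) : Set ((Fin d → Bool) → ℤ) :=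
  {f ∈ FE d α | (Set.range f).ncard = i}


namespace HammingCube

variable {d : ℕ}

/-- The vertex obtained from `x` by flipping coordinate `i`. -/
def flipAt (i : Fin d) (x : Fin d → Bool) : Fin d → Bool := Function.update x i (!x i)

/-- The number of coordinates equal to `1`. -/
def wt (x : Fin d → Bool) : ℕ := (Finset.univ.filter fun i => x i = true).card

lemma flipAt_flipAt (i : Fin d) (x : Fin d → Bool) : flipAt i (flipAt i x) = x := by
  simp [flipAt]

lemma flipAt_apply_self (i : Fin d) (x : Fin d → Bool) : flipAt i x i = !x i := by
  simp [flipAt]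

lemma flipAt_apply_of_ne {i j : Fin d} (h : j ≠ i) (x : Fin d → Bool) :
    flipAt i x j = x j := by
  simp [flipAt, h]

lemma flipAt_injective (i : Fin d) : Function.Injective (flipAt i) := fun x y h => by
  rw [← flipAt_flipAt i x, h, flipAt_flipAt]

lemma flipAt_left_injective (x : Fin d → Bool) :
    Function.Injective fun i => flipAt i x := fun i j h => by
  by_contra hij
  have h1 := congrFun h i
  simp only at h1
  rw [flipAt_apply_self, flipAt_apply_of_ne hij] at h1
  simp at h1

lemma even_wt_flipAt (i : Fin d) (x : Fin d → Bool) :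
    Even (wt (flipAt i x)) ↔ ¬ Even (wt x) := by
  have key (y : Fin d → Bool) : wt y = (if y i = true then 1 else 0) +
      ((Finset.univ.erase i).filter fun j => y j = true).card := by
    unfold wt
    conv_lhs => rw [← Finset.insert_erase (Finset.mem_univ i), Finset.filter_insert]
    split_ifs with h
    · rw [Finset.card_insert_of_notMem (by simp), add_comm]
    · simp
  have h2 : ((Finset.univ.erase i).filter fun j => flipAt i x j = true) =
      ((Finset.univ.erase i).filter fun j => x j = true) := by
    apply Finset.filter_congr
    intro j hj
    rw [flipAt_apply_of_ne (Finset.ne_of_mem_erase hj)]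
  rw [key, key x, h2, flipAt_apply_self]
  cases x i <;> simp [Nat.even_add_one, add_comm 1]

lemma cubeAdj_flipAt (i : Fin d) (x : Fin d → Bool) : cubeAdj d x (flipAt i x) := by
  unfold cubeAdj
  rw [Finset.card_eq_one]
  refine ⟨i, ?_⟩
  ext j
  by_cases h : j = i
  · subst h; simp [flipAt_apply_self]
  · simp [flipAt_apply_of_ne h, h]

lemma two_mul_card_even (hd : 1 ≤ d) :
    2 * (Finset.univ.filter fun x : Fin d → Bool => Even (wt x)).card = 2 ^ d ∧
    2 * (Finset.univ.filter fun x : Fin d → Bool => ¬ Even (wt x)).card = 2 ^ d := by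
  have h1 : (Finset.univ.filter fun x : Fin d → Bool => Even (wt x)).card =
      (Finset.univ.filter fun x : Fin d → Bool => ¬ Even (wt x)).card := by
    refine Finset.card_bij (fun x _ => flipAt ⟨0, hd⟩ x) ?_ ?_ ?_
    · intro x hx
      simp only [Finset.mem_filter, Finset.mem_univ, true_and, even_wt_flipAt] at hx ⊢
      tauto
    · intro x _ y _ h
      exact flipAt_injective _ h
    · intro y hy
      refine ⟨flipAt ⟨0, hd⟩ y, ?_, flipAt_flipAt _ _⟩
      simp only [Finset.mem_filter, Finset.mem_univ, true_and, even_wt_flipAt] at hy ⊢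
      tauto
  have h2 := Finset.card_filter_add_card_filter_not (s := Finset.univ)
    (fun x : Fin d → Bool => Even (wt x))
  have h3 : (Finset.univ : Finset (Fin d → Bool)).card = 2 ^ d := by simp
  omega

lemma mul_logb_add_two_mul_min_le (a b : ℕ) :
    (a : ℝ) * Real.logb 2 a + b * Real.logb 2 b + 2 * min (a : ℝ) b ≤
      (a + b : ℝ) * Real.logb 2 (a + b) := by
  wlog hab : b ≤ a generalizing a b
  · have := this b a (by omega)
    rw [min_comm, add_comm (a : ℝ) b]
    linarith
  rcases Nat.eq_zero_or_pos b with rfl | hb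
  · simp
  have hb' : (0 : ℝ) < b := by exact_mod_cast hb
  have hab' : (b : ℝ) ≤ a := by exact_mod_cast hab
  have ha' : (0 : ℝ) < a := by linarith
  rw [min_eq_right hab']
  have h1 : Real.logb 2 b + 1 ≤ Real.logb 2 (a + b) := by
    have : Real.logb 2 (2 * b) = 1 + Real.logb 2 b := by
      rw [Real.logb_mul (by norm_num) hb'.ne', Real.logb_self_eq_one (by norm_num)]
    rw [add_comm, ← this]
    exact Real.logb_le_logb_of_le (by norm_num) (by positivity) (by linarith)
  have h2 : Real.logb 2 a + b / a ≤ Real.logb 2 (a + b) := by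
    have h3 : (a + b : ℝ) = a * (1 + b / a) := by field_simp
    rw [h3, Real.logb_mul ha'.ne' (by positivity)]
    gcongr
    rw [Real.le_logb_iff_rpow_le (by norm_num) (by positivity)]
    have := rpow_one_add_le_one_add_mul_self (s := 1) (by norm_num) (p := b / a)
      (by positivity) (by rw [div_le_one ha']; exact hab')
    norm_num at this
    exact this
  have h4 : (a : ℝ) * (Real.logb 2 a + b / a) ≤ a * Real.logb 2 (a + b) := by gcongr
  have h5 : (b : ℝ) * (Real.logb 2 b + 1) ≤ b * Real.logb 2 (a + b) := by gcongr
  have h6 : (a : ℝ) * (b / a) = b := by field_simp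
  nlinarith

/-- Edge-isoperimetric inequality in the cube. -/
lemma sum_card_filter_flipAt_le (J : Finset (Fin d)) (S : Finset (Fin d → Bool)) :
    ∑ i ∈ J, ((S.filter fun x => flipAt i x ∈ S).card : ℝ) ≤
      S.card * Real.logb 2 S.card := by
  induction J using Finset.induction_on generalizing S with
  | empty =>
    rw [Finset.sum_empty]
    rcases Nat.eq_zero_or_pos S.card with h | h
    · simp [h]
    · have : (1 : ℝ) ≤ S.card := by exact_mod_cast h
      have := Real.logb_nonneg (b := 2) (by norm_num) this
      positivity
  | insert i J hi ih =>
    set A := S.filter fun x => x i = true with hA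
    set B := S.filter fun x => ¬ x i = true with hB
    have hcard : A.card + B.card = S.card := Finset.card_filter_add_card_filter_not _
    have hsplit : ∀ j ∈ J, ((S.filter fun x => flipAt j x ∈ S).card : ℝ) =
        (A.filter fun x => flipAt j x ∈ A).card + (B.filter fun x => flipAt j x ∈ B).card := by
      intro j hj
      have hji : i ≠ j := fun h => hi (h ▸ hj)
      rw [← Finset.card_filter_add_card_filter_not (s := S.filter fun x => flipAt j x ∈ S)
        (fun x => x i = true)]
      push_cast
      congr 3 <;>
      · ext x
        simp only [hA, hB, Finset.mem_filter, flipAt_apply_of_ne hji]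
        tauto
    have hA' : ((S.filter fun x => flipAt i x ∈ S).filter fun x => x i = true).card ≤
        min A.card B.card := by
      refine le_min (Finset.card_le_card ?_) (Finset.card_le_card_of_injOn (flipAt i) ?_
        (flipAt_injective i).injOn)
      · intro x; simp only [hA, Finset.mem_filter]; tauto
      · intro x; simp [hB, flipAt_apply_self]; tauto
    have hB' : ((S.filter fun x => flipAt i x ∈ S).filter fun x => ¬ x i = true).card ≤
        min A.card B.card := by
      refine le_min (Finset.card_le_card_of_injOn (flipAt i) ?_
        (flipAt_injective i).injOn) (Finset.card_le_card ?_)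
      · intro x; simp [hA, flipAt_apply_self]; tauto
      · intro x; simp only [hB, Finset.mem_filter]; tauto
    have hi' := Finset.card_filter_add_card_filter_not
      (s := S.filter fun x => flipAt i x ∈ S) (fun x => x i = true)
    have hi2 : ((S.filter fun x => flipAt i x ∈ S).card : ℝ) ≤ 2 * min (A.card : ℝ) B.card := by
      rw [← Nat.cast_min]
      exact_mod_cast (by omega : (S.filter fun x => flipAt i x ∈ S).card ≤ 2 * min A.card B.card)
    rw [Finset.sum_insert hi, Finset.sum_congr rfl hsplit, Finset.sum_add_distrib, ← hcard]
    have := mul_logb_add_two_mul_min_le A.card B.card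
    push_cast
    linarith [ih A, ih B]

/-- If every vertex of `T` has at least `(1 + γ) / 2 * d` neighbours in `F` and
`3 * |F| ≤ 2 ^ (γ d)`, then `|T| ≤ γ |F|`. -/
lemma card_le_mul_card_of_neighbors {γ : ℝ} (hγ0 : 0 < γ) (hd : 1 ≤ d)
    {T F : Finset (Fin d → Bool)} (hdisj : Disjoint T F)
    (hT : ∀ x ∈ T, (1 + γ) / 2 * d ≤ ((Finset.univ.filter fun i => flipAt i x ∈ F).card : ℝ))
    (hF : 3 * (F.card : ℝ) ≤ 2 ^ (γ * d)) : (T.card : ℝ) ≤ γ * F.card := by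
  have hd' : (0 : ℝ) < d := by exact_mod_cast hd
  set e : ℝ := ∑ i : Fin d, ((T.filter fun x => flipAt i x ∈ F).card : ℝ) with he
  have hcount : e = ∑ x ∈ T, ((Finset.univ.filter fun i => flipAt i x ∈ F).card : ℝ) := by
    simp only [he, Finset.card_filter, Nat.cast_sum]
    rw [Finset.sum_comm]
  have hlow : (1 + γ) / 2 * d * T.card ≤ e := by
    rw [hcount, mul_comm, ← nsmul_eq_mul]
    exact Finset.card_nsmul_le_sum _ _ _ hT
  have hTF : ∀ i : Fin d, (T.filter fun x => flipAt i x ∈ F).card ≤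
      (F.filter fun x => flipAt i x ∈ T).card := by
    intro i
    refine Finset.card_le_card_of_injOn (flipAt i) ?_ (flipAt_injective i).injOn
    intro x
    simp [flipAt_flipAt]
    tauto
  have hup : e ≤ d * F.card := by
    have : ∀ i ∈ (Finset.univ : Finset (Fin d)),
        ((T.filter fun x => flipAt i x ∈ F).card : ℝ) ≤ F.card := by
      intro i _
      exact_mod_cast (hTF i).trans (Finset.card_filter_le _ _)
    simpa using Finset.sum_le_sum this
  have hT2 : (T.card : ℝ) ≤ 2 * F.card := by
    have h1 : (d : ℝ) * ((1 + γ) / 2 * T.card) ≤ d * F.card := by linarith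
    have h2 := le_of_mul_le_mul_left h1 hd'
    nlinarith [(Nat.cast_nonneg T.card : (0 : ℝ) ≤ T.card)]
  rcases Nat.eq_zero_or_pos T.card with h0 | h0
  · rw [h0]
    simpa using mul_nonneg hγ0.le (Nat.cast_nonneg F.card)
  have hTpos : (0 : ℝ) < T.card := by exact_mod_cast h0
  have hiso := sum_card_filter_flipAt_le Finset.univ (T ∪ F)
  rw [Finset.card_union_of_disjoint hdisj] at hiso
  push_cast at hiso
  have h2e : 2 * e ≤ ∑ i : Fin d, (((T ∪ F).filter fun x => flipAt i x ∈ T ∪ F).card : ℝ) := by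
    rw [he, Finset.mul_sum]
    refine Finset.sum_le_sum fun i _ => ?_
    have h1 : (T.filter fun x => flipAt i x ∈ F).card + (F.filter fun x => flipAt i x ∈ T).card ≤
        ((T ∪ F).filter fun x => flipAt i x ∈ T ∪ F).card := by
      rw [← Finset.card_union_of_disjoint]
      · apply Finset.card_le_card
        intro x
        simp only [Finset.mem_union, Finset.mem_filter]
        tauto
      · exact hdisj.mono (Finset.filter_subset _ _) (Finset.filter_subset _ _)
    have h2 := hTF i
    exact_mod_cast (by omega : 2 * (T.filter fun x => flipAt i x ∈ F).card ≤ _)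
  have hlog : Real.logb 2 (T.card + F.card) ≤ γ * d := by
    rw [Real.logb_le_iff_le_rpow (by norm_num) (by positivity)]
    linarith
  have h3 : ((T.card : ℝ) + F.card) * Real.logb 2 (T.card + F.card) ≤
      (T.card + F.card) * (γ * d) := by gcongr
  have h4 : (d : ℝ) * ((1 + γ) * T.card) ≤ d * ((T.card + F.card) * γ) := by linarith
  have h5 := le_of_mul_le_mul_left h4 hd'
  linarith

section Walks

variable {N M : Type*} [DecidableEq N] [DecidableEq M]

/-- The sets of vertices visited by walks with `n` steps starting at a vertex. -/
def walkSets (nbr : N → Finset N) : ℕ → N → Finset (Finset N)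
  | 0, v => {{v}}
  | n + 1, v => (nbr v).biUnion fun y => (walkSets nbr n y).image (insert v)

lemma mem_walkSets_succ {nbr : N → Finset N} {n : ℕ} {v : N} {S : Finset N} :
    S ∈ walkSets nbr (n + 1) v ↔ ∃ y ∈ nbr v, ∃ S' ∈ walkSets nbr n y, insert v S' = S := by
  simp [walkSets]

lemma card_walkSets_le {nbr : N → Finset N} {K : ℕ} (hK : ∀ v, (nbr v).card ≤ K) (n : ℕ)
    (v : N) : (walkSets nbr n v).card ≤ K ^ n := by
  induction n generalizing v with
  | zero => simp [walkSets]
  | succ n ih =>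
    rw [walkSets, pow_succ, mul_comm]
    refine (Finset.card_biUnion_le_card_mul _ _ _ fun y _ =>
      Finset.card_image_le.trans (ih y)).trans ?_
    gcongr
    exact hK v

lemma mem_of_mem_walkSets {nbr : N → Finset N} {n : ℕ} {v : N} {S : Finset N}
    (h : S ∈ walkSets nbr n v) : v ∈ S := by
  cases n with
  | zero => simp_all [walkSets]
  | succ n =>
    obtain ⟨y, _, S', _, rfl⟩ := mem_walkSets_succ.1 h
    simp

lemma walkSets_mono {nbr : N → Finset N} (hrefl : ∀ v, v ∈ nbr v) {m n : ℕ} (hmn : m ≤ n)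
    (v : N) : walkSets nbr m v ⊆ walkSets nbr n v := by
  induction n, hmn using Nat.le_induction with
  | base => rfl
  | succ n _ ih =>
    intro S hS
    exact mem_walkSets_succ.2 ⟨v, hrefl v, S, ih hS, Finset.insert_eq_self.2
      (mem_of_mem_walkSets hS)⟩

lemma insert_mem_walkSets {nbr : N → Finset N} (hsymm : ∀ v w, w ∈ nbr v → v ∈ nbr w)
    {n : ℕ} {v s x : N} {S : Finset N} (hS : S ∈ walkSets nbr n v) (hs : s ∈ S)
    (hx : x ∈ nbr s) : insert x S ∈ walkSets nbr (n + 2) v := by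
  have base {n : ℕ} {v : N} {S : Finset N} (hS : S ∈ walkSets nbr n v) (hx : x ∈ nbr v) :
      insert x S ∈ walkSets nbr (n + 2) v := by
    refine mem_walkSets_succ.2 ⟨x, hx, insert x S,
      mem_walkSets_succ.2 ⟨v, hsymm _ _ hx, S, hS, rfl⟩, ?_⟩
    rw [Finset.insert_eq_self]
    exact Finset.mem_insert_of_mem (mem_of_mem_walkSets hS)
  induction n generalizing v S with
  | zero =>
    have : s = v := by simp_all [walkSets]
    exact base hS (this ▸ hx)
  | succ n ih =>
    obtain ⟨y, hy, S', hS', rfl⟩ := mem_walkSets_succ.1 hS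
    rcases Finset.mem_insert.1 hs with rfl | hs'
    · exact base hS hx
    · rw [Finset.insert_comm]
      exact mem_walkSets_succ.2 ⟨y, hy, _, ih hS' hs', rfl⟩

/-- A connected set `X` is visited by a walk with at most `2 (|X| - 1)` steps. -/
lemma mem_walkSets_of_connected {nbr : N → Finset N} (hrefl : ∀ v, v ∈ nbr v)
    (hsymm : ∀ v w, w ∈ nbr v → v ∈ nbr w) {X : Finset N} {v : N} (hv : v ∈ X)
    (hcut : ∀ S ⊂ X, v ∈ S → ∃ s ∈ S, ∃ x ∈ X, x ∉ S ∧ x ∈ nbr s) {n : ℕ}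
    (hn : 2 * X.card ≤ n + 2) : X ∈ walkSets nbr n v := by
  have key (k : ℕ) (hk : k < X.card) :
      ∃ S ⊆ X, S.card = k + 1 ∧ v ∈ S ∧ S ∈ walkSets nbr (2 * k) v := by
    induction k with
    | zero => exact ⟨{v}, by simpa using hv, by simp, by simp, by simp [walkSets]⟩
    | succ k ih =>
      obtain ⟨S, hSX, hcard, hvS, hS⟩ := ih (by omega)
      have hss : S ⊂ X := hSX.ssubset_of_ne fun h => by rw [h] at hcard; omega
      obtain ⟨s, hs, x, hx, hxS, hxs⟩ := hcut S hss hvS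
      exact ⟨insert x S, Finset.insert_subset hx hSX,
        by rw [Finset.card_insert_of_notMem hxS, hcard], Finset.mem_insert_of_mem hvS,
        insert_mem_walkSets hsymm hS hs hxs⟩
  have hpos : 0 < X.card := Finset.card_pos.2 ⟨v, hv⟩
  obtain ⟨S, hSX, hcard, -, hS⟩ := key (X.card - 1) (by omega)
  rw [Finset.eq_of_subset_of_card_le hSX (by omega)] at hS
  exact walkSets_mono hrefl (by omega) v hS

/-- A subset of `L` of size at most `|D(X)| / s` whose neighbourhood misses fewer than `s`
neighbours of each element of `L`. -/
lemma exists_greedy_subset (D : N → Finset M) (L : Finset N) {s : ℝ} (hs : 0 < s) :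
    ∃ X ⊆ L, X.card * s ≤ (X.biUnion D).card ∧
      ∀ a ∈ L, ((D a \ X.biUnion D).card : ℝ) < s := by
  classical
  obtain ⟨X, hX, hmax⟩ := Finset.exists_max_image
    (L.powerset.filter fun X => X.card * s ≤ ((X.biUnion D).card : ℝ)) Finset.card
    ⟨∅, by simp⟩
  simp only [Finset.mem_filter, Finset.mem_powerset] at hX hmax
  refine ⟨X, hX.1, hX.2, fun a ha => ?_⟩
  by_contra! hcon
  have haX : a ∉ X := fun h => by
    rw [Finset.sdiff_eq_empty_iff_subset.2 (Finset.subset_biUnion_of_mem D h)] at hcon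
    simp at hcon
    linarith
  have hcard : (insert a X).card = X.card + 1 := Finset.card_insert_of_notMem haX
  have := hmax (insert a X) ⟨Finset.insert_subset ha hX.1, ?_⟩
  · omega
  · rw [hcard, Finset.biUnion_insert, ← Finset.sdiff_union_self_eq_union,
      Finset.card_union_of_disjoint Finset.sdiff_disjoint]
    push_cast
    linarith [hX.2]

end Walks

section Towers

/-- The neighbours of a vertex one level below. -/
def lower (p : (Fin d → Bool) × ℤ) : Finset ((Fin d → Bool) × ℤ) :=
  Finset.univ.image fun i => (flipAt i p.1, p.2 - 1)

/-- The neighbours of a vertex one level above. -/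
def upper (p : (Fin d → Bool) × ℤ) : Finset ((Fin d → Bool) × ℤ) :=
  Finset.univ.image fun i => (flipAt i p.1, p.2 + 1)

/-- The vertices of the same level sharing a neighbour with a given one. -/
def near (p : (Fin d → Bool) × ℤ) : Finset ((Fin d → Bool) × ℤ) :=
  Finset.univ.image fun q : Fin d × Fin d => (flipAt q.1 (flipAt q.2 p.1), p.2)

/-- The union of `near`, `lower` and `upper`. -/
def link (p : (Fin d → Bool) × ℤ) : Finset ((Fin d → Bool) × ℤ) :=
  near p ∪ lower p ∪ upper p

/-- The vertices reached by a `near` step, a `link` step and a `near` step. -/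
def farNear (p : (Fin d → Bool) × ℤ) : Finset ((Fin d → Bool) × ℤ) :=
  ((near p).biUnion link).biUnion near

lemma mem_lower {p q : (Fin d → Bool) × ℤ} :
    q ∈ lower p ↔ ∃ i, (flipAt i p.1, p.2 - 1) = q := by simp [lower]

lemma mem_upper {p q : (Fin d → Bool) × ℤ} :
    q ∈ upper p ↔ ∃ i, (flipAt i p.1, p.2 + 1) = q := by simp [upper]

lemma mem_near {p q : (Fin d → Bool) × ℤ} :
    q ∈ near p ↔ ∃ i j, (flipAt i (flipAt j p.1), p.2) = q := by simp [near]

lemma mem_farNear {p q : (Fin d → Bool) × ℤ} :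
    q ∈ farNear p ↔ ∃ a ∈ near p, ∃ b ∈ link a, q ∈ near b := by
  simp only [farNear, Finset.mem_biUnion]
  constructor
  · rintro ⟨b, ⟨a, ha, hb⟩, hq⟩
    exact ⟨a, ha, b, hb, hq⟩
  · rintro ⟨a, ha, b, hb, hq⟩
    exact ⟨b, ⟨a, ha, hb⟩, hq⟩

lemma mem_upper_iff_mem_lower {p q : (Fin d → Bool) × ℤ} : q ∈ upper p ↔ p ∈ lower q := by
  rw [mem_upper, mem_lower]
  constructor <;>
  · rintro ⟨i, rfl⟩
    exact ⟨i, by simp [flipAt_flipAt]⟩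

lemma mem_near_comm {p q : (Fin d → Bool) × ℤ} : q ∈ near p ↔ p ∈ near q := by
  simp only [mem_near]
  constructor <;>
  · rintro ⟨i, j, rfl⟩
    exact ⟨j, i, by simp [flipAt_flipAt]⟩

lemma mem_link_comm {p q : (Fin d → Bool) × ℤ} : q ∈ link p ↔ p ∈ link q := by
  simp only [link, Finset.mem_union, mem_near_comm (p := p), mem_upper_iff_mem_lower]
  tauto

lemma mem_near_self (hd : 1 ≤ d) (p : (Fin d → Bool) × ℤ) : p ∈ near p :=
  mem_near.2 ⟨⟨0, hd⟩, ⟨0, hd⟩, by simp [flipAt_flipAt]⟩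

lemma mem_near_of_mem_lower {p q r : (Fin d → Bool) × ℤ} (hp : r ∈ lower p)
    (hq : r ∈ lower q) : q ∈ near p := by
  obtain ⟨i, rfl⟩ := mem_lower.1 hp
  obtain ⟨j, hj⟩ := mem_lower.1 hq
  simp only [Prod.mk.injEq] at hj
  refine mem_near.2 ⟨j, i, Prod.ext ?_ ?_⟩
  · simp only [← hj.1, flipAt_flipAt]
  · simp only
    omega

lemma card_farNear_le (hd : 1 ≤ d) (p : (Fin d → Bool) × ℤ) :
    (farNear p).card ≤ 3 * d ^ 6 := by
  have hnear (p : (Fin d → Bool) × ℤ) : (near p).card ≤ d * d := by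
    simpa [near] using Finset.card_image_le (s := (Finset.univ : Finset (Fin d × Fin d)))
      (f := fun q => (flipAt q.1 (flipAt q.2 p.1), p.2))
  have hlower (p : (Fin d → Bool) × ℤ) : (lower p).card ≤ d := by
    simpa [lower] using Finset.card_image_le (s := (Finset.univ : Finset (Fin d)))
      (f := fun i => (flipAt i p.1, p.2 - 1))
  have hupper (p : (Fin d → Bool) × ℤ) : (upper p).card ≤ d := by
    simpa [upper] using Finset.card_image_le (s := (Finset.univ : Finset (Fin d)))
      (f := fun i => (flipAt i p.1, p.2 + 1))
  have hlink (p : (Fin d → Bool) × ℤ) : (link p).card ≤ 3 * (d * d) := by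
    have h1 := Finset.card_union_le (near p ∪ lower p) (upper p)
    have h2 := Finset.card_union_le (near p) (lower p)
    have := hnear p; have := hlower p; have := hupper p
    unfold link
    nlinarith
  calc (farNear p).card ≤ ((near p).biUnion link).card * (d * d) :=
        Finset.card_biUnion_le_card_mul _ _ _ fun q _ => hnear q
    _ ≤ ((near p).card * (3 * (d * d))) * (d * d) := by
        gcongr
        exact Finset.card_biUnion_le_card_mul _ _ _ fun q _ => hlink q
    _ ≤ ((d * d) * (3 * (d * d))) * (d * d) := by gcongr; exact hnear p
    _ = 3 * d ^ 6 := by ring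

/-- The sets of pairs `(x, j)` with `2 ≤ j ≤ m x` and `j` of the parity of `m x`, where `m` is the
absolute value of a polymer with boundary of size at most `g`. -/
structure IsTower (g : ℕ) (L : Finset ((Fin d → Bool) × ℤ)) : Prop where
  two_le : ∀ p ∈ L, 2 ≤ p.2
  parity : ∀ p ∈ L, Even p.2 ↔ Even (wt p.1)
  down : ∀ p ∈ L, 3 ≤ p.2 → lower p ⊆ L
  level_card : ∀ j, (L.filter fun p => p.2 = j).card ≤ g
  shadow_card : ((L.biUnion lower).filter fun p => p.2 = 1).card ≤ g
  nonempty : L.Nonempty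
  linked : ∀ p ∈ L, ∀ q ∈ L, p.2 = 2 → q.2 = 2 →
    Relation.ReflTransGen (fun a b => b ∈ L ∧ b ∈ near a) p q

lemma IsTower.exists_level_two_reachable {g : ℕ} {L : Finset ((Fin d → Bool) × ℤ)}
    (h : IsTower g L) (hd : 1 ≤ d) {p : (Fin d → Bool) × ℤ} (hp : p ∈ L) :
    ∃ q ∈ L, q.2 = 2 ∧ Relation.ReflTransGen (fun a b => b ∈ L ∧ b ∈ link a) q p := by
  obtain ⟨x, j⟩ := p
  have hj : 2 ≤ j := h.two_le _ hp
  induction j, hj using Int.leInduction generalizing x with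
  | base => exact ⟨_, hp, rfl, .refl⟩
  | succ j hj ih =>
    have hmem : (flipAt ⟨0, hd⟩ x, j) ∈ lower (x, j + 1) :=
      mem_lower.2 ⟨⟨0, hd⟩, by simp⟩
    have hL := h.down _ hp (by simp only; omega) hmem
    obtain ⟨q, hq, hq2, hqr⟩ := ih _ hL
    refine ⟨q, hq, hq2, hqr.tail ⟨hp, ?_⟩⟩
    rw [link, Finset.mem_union]
    exact Or.inr (mem_upper_iff_mem_lower.2 hmem)

lemma IsTower.reachable {g : ℕ} {L : Finset ((Fin d → Bool) × ℤ)} (h : IsTower g L)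
    (hd : 1 ≤ d) {p q : (Fin d → Bool) × ℤ} (hp : p ∈ L) (hp2 : p.2 = 2) (hq : q ∈ L) :
    Relation.ReflTransGen (fun a b => b ∈ L ∧ b ∈ link a) p q := by
  obtain ⟨r, hr, hr2, hrq⟩ := h.exists_level_two_reachable hd hq
  exact (Relation.ReflTransGen.mono (fun a b hab => ⟨hab.1, by simp [link, hab.2]⟩) _ _
    (h.linked p hp r hr hp2 hr2)).trans hrq

/-- A subset of a tower meeting the `near` neighbourhood of each element is visited by a short
`farNear` walk. -/
lemma IsTower.exists_mem_walkSets {g : ℕ} {L X : Finset ((Fin d → Bool) × ℤ)}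
    (h : IsTower g L) (hd : 1 ≤ d) (hXL : X ⊆ L) (hX : ∀ a ∈ L, ∃ p ∈ X, a ∈ near p) {n : ℕ}
    (hn : 2 * X.card ≤ n + 2) : ∃ x, X ∈ walkSets farNear n (x, 2) := by
  obtain ⟨a, ha⟩ := h.nonempty
  obtain ⟨b, hb, hb2, -⟩ := h.exists_level_two_reachable hd ha
  obtain ⟨v, hv, hbv⟩ := hX b hb
  have hv2 : v.2 = 2 := by
    obtain ⟨i, j, rfl⟩ := mem_near.1 hbv
    exact hb2
  have hfar_refl (p : (Fin d → Bool) × ℤ) : p ∈ farNear p :=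
    mem_farNear.2 ⟨p, mem_near_self hd p, p, by simp [link, mem_near_self hd p],
      mem_near_self hd p⟩
  refine ⟨v.1, ?_⟩
  rw [← hv2]
  refine mem_walkSets_of_connected hfar_refl ?_ hv ?_ hn
  · intro p q hq
    obtain ⟨a, ha, b, hb, hq⟩ := mem_farNear.1 hq
    exact mem_farNear.2 ⟨b, mem_near_comm.1 hq, a, mem_link_comm.1 hb, mem_near_comm.1 ha⟩
  · intro S hS hvS
    by_contra! hcut
    obtain ⟨x, hxX, hxS⟩ := Finset.exists_of_ssubset hS
    have hinv (a : (Fin d → Bool) × ℤ)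
        (hreach : Relation.ReflTransGen (fun a b => b ∈ L ∧ b ∈ link a) v a) :
        a ∈ L ∧ ∀ q ∈ X, a ∈ near q → q ∈ S := by
      induction hreach with
      | refl =>
        refine ⟨hXL hv, fun q hq hvq => ?_⟩
        by_contra hqS
        exact hcut v hvS q hq hqS (mem_farNear.2 ⟨v, mem_near_self hd v, v,
          by simp [link, mem_near_self hd v], mem_near_comm.1 hvq⟩)
      | @tail b c _ hbc ih =>
        refine ⟨hbc.1, fun q hq hcq => ?_⟩
        obtain ⟨p, hp, hbp⟩ := hX b ih.1
        by_contra hqS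
        exact hcut p (ih.2 p hp hbp) q hq hqS (mem_farNear.2 ⟨b, hbp, c, hbc.2,
          mem_near_comm.1 hcq⟩)
    exact hxS ((hinv x (h.reachable hd (hXL hv) hv2 (hXL hxX))).2 x hxX (mem_near_self hd x))

/-- The pairs most of whose lower neighbours are in the lower shadow of `X`. -/
noncomputable def container (γ : ℝ) (X : Finset ((Fin d → Bool) × ℤ)) :
    Finset ((Fin d → Bool) × ℤ) :=
  ((X.biUnion lower).biUnion upper).filter fun p => 2 ≤ p.2 ∧ (Even p.2 ↔ Even (wt p.1)) ∧
    (1 + γ) / 2 * d ≤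
      ((Finset.univ.filter fun i => (flipAt i p.1, p.2 - 1) ∈ X.biUnion lower).card : ℝ)

/-- The part of the lower shadow of `X` of level at least `2`. -/
def kernel (X : Finset ((Fin d → Bool) × ℤ)) : Finset ((Fin d → Bool) × ℤ) :=
  (X.biUnion lower).filter fun p => 2 ≤ p.2

lemma card_container_le {γ : ℝ} (hγ0 : 0 < γ) (hd : 1 ≤ d) {X : Finset ((Fin d → Bool) × ℤ)}
    (hX : ∀ p ∈ X, (Even p.2 ↔ Even (wt p.1)))
    (hlev : ∀ j : ℤ, 1 ≤ j →
      3 * (((X.biUnion lower).filter fun p => p.2 = j).card : ℝ) ≤ 2 ^ (γ * d)) :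
    ((container γ X).card : ℝ) ≤ γ * (X.biUnion lower).card := by
  set F := X.biUnion lower with hF
  set T := container γ X with hT
  have hFpar : ∀ p ∈ F, (Even p.2 ↔ Even (wt p.1)) := by
    intro p hp
    obtain ⟨q, hq, hpq⟩ := Finset.mem_biUnion.1 hp
    obtain ⟨i, rfl⟩ := mem_lower.1 hpq
    simp only [even_wt_flipAt, Int.even_sub_one, hX q hq]
  have hslice (j : ℤ) (S : Finset ((Fin d → Bool) × ℤ)) :
      ((S.filter fun p => p.2 = j).image Prod.fst).card = (S.filter fun p => p.2 = j).card := by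
    apply Finset.card_image_of_injOn
    intro p hp q hq hpq
    simp only [Finset.coe_filter, Set.mem_ofPred_eq] at hp hq
    exact Prod.ext hpq (hp.2.trans hq.2.symm)
  have hlevel : ∀ j ∈ T.image Prod.snd, ((T.filter fun p => p.2 = j).card : ℝ) ≤
      γ * (F.filter fun p => p.2 + 1 = j).card := by
    intro j hj
    obtain ⟨p, hp, rfl⟩ := Finset.mem_image.1 hj
    have hp2 : 2 ≤ p.2 := (Finset.mem_filter.1 hp).2.1
    have hFj : (F.filter fun q => q.2 + 1 = p.2) = F.filter fun q => q.2 = p.2 - 1 :=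
      Finset.filter_congr fun q _ => by omega
    rw [hFj, ← hslice, ← hslice]
    refine card_le_mul_card_of_neighbors hγ0 hd ?_ ?_ ?_
    · rw [Finset.disjoint_left]
      intro x hx hx'
      obtain ⟨q, hq, rfl⟩ := Finset.mem_image.1 hx
      obtain ⟨r, hr, hrq⟩ := Finset.mem_image.1 hx'
      rw [Finset.mem_filter] at hq hr
      have h1 := (Finset.mem_filter.1 hq.1).2.2.1
      have h2 := hFpar r hr.1
      rw [hrq, ← h1, hr.2, hq.2, Int.even_sub_one] at h2
      tauto
    · intro x hx
      obtain ⟨q, hq, rfl⟩ := Finset.mem_image.1 hx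
      rw [Finset.mem_filter] at hq
      refine (Finset.mem_filter.1 hq.1).2.2.2.trans ?_
      norm_cast
      apply Finset.card_le_card
      intro i hi
      simp only [Finset.mem_filter, Finset.mem_univ, true_and] at hi ⊢
      exact Finset.mem_image.2 ⟨_, Finset.mem_filter.2 ⟨hi, by simp [hq.2]⟩, rfl⟩
    · rw [hslice]
      exact hlev _ (by omega)
  have h1 : (T.card : ℝ) = ∑ j ∈ T.image Prod.snd, ((T.filter fun p => p.2 = j).card : ℝ) := by
    rw [Finset.card_eq_sum_card_image Prod.snd T]
    push_cast
    rfl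
  have h2 : ∑ j ∈ T.image Prod.snd, ((F.filter fun p => p.2 + 1 = j).card : ℝ) ≤ F.card := by
    have := Finset.sum_card_fiberwise_eq_card_filter F (T.image Prod.snd) (fun p => p.2 + 1)
    exact_mod_cast this.le.trans (Finset.card_filter_le _ _)
  rw [h1]
  refine (Finset.sum_le_sum hlevel).trans ?_
  rw [← Finset.mul_sum]
  gcongr

/-- Every tower is sandwiched between the kernel and the container of a small connected set. -/
lemma IsTower.exists_container {γ : ℝ} (hγ0 : 0 < γ) (hγ1 : γ < 1) (hd : 1 ≤ d) {g n : ℕ}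
    (hg : 3 * (g : ℝ) ≤ 2 ^ (γ * d)) (hn : 4 * g / ((1 - γ) ^ 2 * d) ≤ (n : ℝ))
    {L : Finset ((Fin d → Bool) × ℤ)} (h : IsTower g L) :
    ∃ X, (∃ x, X ∈ walkSets farNear n (x, 2)) ∧ kernel X ⊆ L ∧ L ⊆ container γ X ∧
      ((container γ X).card : ℝ) ≤ (kernel X).card + γ * g := by
  have hd' : (0 : ℝ) < d := by exact_mod_cast hd
  obtain ⟨X, hXL, hXcard, hXg⟩ := exists_greedy_subset lower L
    (s := (1 - γ) / 2 * d) (mul_pos (by linarith) hd')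
  set F := X.biUnion lower with hF
  have hlower (p : (Fin d → Bool) × ℤ) : (lower p).card = d := by
    rw [lower, Finset.card_image_of_injective, Finset.card_univ, Fintype.card_fin]
    intro i j hij
    exact flipAt_left_injective p.1 (Prod.ext_iff.1 hij).1
  have hFL : F ⊆ L.biUnion lower := Finset.biUnion_subset_biUnion_of_subset_left _ hXL
  have hF1 : ∀ p ∈ F, p.2 ≠ 1 → p ∈ L := by
    intro p hp hp1
    obtain ⟨q, hq, hpq⟩ := Finset.mem_biUnion.1 hp
    refine h.down q (hXL hq) ?_ hpq
    have := h.two_le q (hXL hq)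
    obtain ⟨i, rfl⟩ := mem_lower.1 hpq
    simp only at hp1
    omega
  have hFlev (j : ℤ) : (F.filter fun p => p.2 = j).card ≤ g := by
    by_cases hj : j = 1
    · subst hj
      exact (Finset.card_le_card (Finset.filter_subset_filter _ hFL)).trans h.shadow_card
    · refine (Finset.card_le_card ?_).trans (h.level_card j)
      intro p hp
      rw [Finset.mem_filter] at hp ⊢
      exact ⟨hF1 p hp.1 (by rw [hp.2]; exact hj), hp.2⟩
  have hkernel : kernel X ⊆ L := by
    intro p hp
    have hp := Finset.mem_filter.1 hp
    exact hF1 p hp.1 (by omega)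
  have hFcount (p) (hp : p ∈ L) : (1 + γ) / 2 * d <
      ((Finset.univ.filter fun i => (flipAt i p.1, p.2 - 1) ∈ F).card : ℝ) := by
    have h1 := hXg p hp
    have h2 : (Finset.univ.filter fun i => (flipAt i p.1, p.2 - 1) ∈ F).card =
        (lower p ∩ F).card := by
      rw [← Finset.card_image_of_injective (s := Finset.univ.filter _)
        (f := fun i => (flipAt i p.1, p.2 - 1))
        fun i j hij => flipAt_left_injective p.1 (Prod.ext_iff.1 hij).1]
      congr 1
      ext q
      simp only [Finset.mem_image, Finset.mem_filter, Finset.mem_univ, true_and, Finset.mem_inter,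
        mem_lower]
      constructor
      · rintro ⟨i, hi, rfl⟩
        exact ⟨⟨i, rfl⟩, hi⟩
      · rintro ⟨⟨i, rfl⟩, hi⟩
        exact ⟨i, hi, rfl⟩
    have h3 := Finset.card_sdiff_add_card_inter (lower p) F
    rw [hlower] at h3
    have h4 : ((lower p \ F).card : ℝ) + (lower p ∩ F).card = d := by exact_mod_cast h3
    rw [h2]
    linarith
  have hcount_pos (p) (hp : p ∈ L) : ∃ i, (flipAt i p.1, p.2 - 1) ∈ F := by
    by_contra! hcon
    have := hFcount p hp
    simp only [hcon, Finset.filter_false, Finset.card_empty, Nat.cast_zero] at this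
    nlinarith
  have hLT : L ⊆ container γ X := by
    intro p hp
    obtain ⟨i, hi⟩ := hcount_pos p hp
    refine Finset.mem_filter.2 ⟨Finset.mem_biUnion.2 ⟨_, hi, mem_upper_iff_mem_lower.2
      (mem_lower.2 ⟨i, rfl⟩)⟩, h.two_le p hp, h.parity p hp, (hFcount p hp).le⟩
  have hT := card_container_le hγ0 hd (fun p hp => h.parity p (hXL hp)) (fun j _ =>
    (by gcongr; exact_mod_cast hFlev j : _ ≤ 3 * (g : ℝ)).trans hg)
  have hFsplit : (F.card : ℝ) ≤ (kernel X).card + g := by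
    have h1 := Finset.card_filter_add_card_filter_not (s := F) (fun p => 2 ≤ p.2)
    have h2 : (F.filter fun p => ¬ 2 ≤ p.2).card ≤ g := by
      refine (Finset.card_le_card ?_).trans (hFlev 1)
      intro p hp
      rw [Finset.mem_filter] at hp ⊢
      refine ⟨hp.1, ?_⟩
      obtain ⟨q, hq, hpq⟩ := Finset.mem_biUnion.1 hp.1
      have := h.two_le q (hXL hq)
      obtain ⟨i, rfl⟩ := mem_lower.1 hpq
      simp only at hp ⊢
      omega
    have h3 : F.card ≤ (kernel X).card + g := by
      rw [kernel, ← hF]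
      omega
    exact_mod_cast h3
  have hKT : ((kernel X).card : ℝ) ≤ (container γ X).card := by
    exact_mod_cast Finset.card_le_card (hkernel.trans hLT)
  have hX : ((2 * X.card : ℕ) : ℝ) ≤ n := by
    refine le_trans ?_ hn
    rw [le_div_iff₀ (mul_pos (pow_pos (by linarith) 2) hd')]
    have h1 : (1 - γ) * F.card ≤ g := by linarith
    have h2 : (1 - γ) * (X.card * ((1 - γ) / 2 * d)) ≤ (1 - γ) * F.card :=
      mul_le_mul_of_nonneg_left hXcard (by linarith)
    push_cast
    nlinarith
  refine ⟨X, h.exists_mem_walkSets hd hXL ?_ ?_, hkernel, hLT, ?_⟩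
  · intro a ha
    obtain ⟨i, hi⟩ := hcount_pos a ha
    obtain ⟨p, hp, hip⟩ := Finset.mem_biUnion.1 hi
    exact ⟨p, hp, mem_near_of_mem_lower hip (mem_lower.2 ⟨i, rfl⟩)⟩
  · have : 2 * X.card ≤ n := by exact_mod_cast hX
    omega
  · have h1 : γ * F.card ≤ γ * ((kernel X).card + g) := by gcongr
    have h2 : γ * ((kernel X).card : ℝ) ≤ (kernel X).card :=
      mul_le_of_le_one_left (Nat.cast_nonneg _) hγ1.le
    linarith

theorem card_towers_le {γ : ℝ} (hγ0 : 0 < γ) (hγ1 : γ < 1) (hd : 1 ≤ d) {g n : ℕ}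
    (hg : 3 * (g : ℝ) ≤ 2 ^ (γ * d)) (hn : 4 * g / ((1 - γ) ^ 2 * d) ≤ (n : ℝ))
    {𝒯 : Finset (Finset ((Fin d → Bool) × ℤ))} (h𝒯 : ∀ L ∈ 𝒯, IsTower g L) :
    (𝒯.card : ℝ) ≤ 2 ^ d * (3 * d ^ 6) ^ n * (2 : ℝ) ^ (γ * g) := by
  set 𝒳 : Finset (Finset ((Fin d → Bool) × ℤ)) :=
    (Finset.univ : Finset (Fin d → Bool)).biUnion fun x => walkSets farNear n (x, 2) with h𝒳
  have h𝒳card : 𝒳.card ≤ 2 ^ d * (3 * d ^ 6) ^ n := by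
    refine (Finset.card_biUnion_le_card_mul _ _ _ fun x _ =>
      card_walkSets_le (card_farNear_le hd) n _).trans ?_
    simp
  have hsub : 𝒯 ⊆ (𝒳.filter fun X => kernel X ⊆ container γ X ∧
      ((container γ X).card : ℝ) ≤ (kernel X).card + γ * g).biUnion
      fun X => Finset.Icc (kernel X) (container γ X) := by
    intro L hL
    obtain ⟨X, ⟨x, hx⟩, hKL, hLT, hcard⟩ := (h𝒯 L hL).exists_container hγ0 hγ1 hd hg hn
    refine Finset.mem_biUnion.2 ⟨X, Finset.mem_filter.2 ⟨?_, hKL.trans hLT, hcard⟩,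
      Finset.mem_Icc.2 ⟨hKL, hLT⟩⟩
    exact Finset.mem_biUnion.2 ⟨x, Finset.mem_univ _, hx⟩
  calc (𝒯.card : ℝ) ≤ ((∑ X ∈ 𝒳.filter fun X => kernel X ⊆ container γ X ∧
        ((container γ X).card : ℝ) ≤ (kernel X).card + γ * g,
        (Finset.Icc (kernel X) (container γ X)).card : ℕ) : ℝ) := by
        exact_mod_cast (Finset.card_le_card hsub).trans Finset.card_biUnion_le
    _ ≤ ∑ X ∈ 𝒳.filter fun X => kernel X ⊆ container γ X ∧
        ((container γ X).card : ℝ) ≤ (kernel X).card + γ * g, (2 : ℝ) ^ (γ * g) := by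
        push_cast
        refine Finset.sum_le_sum fun X hX => ?_
        obtain ⟨-, hKT, hcard⟩ := Finset.mem_filter.1 hX
        rw [Finset.card_Icc_finset hKT]
        push_cast
        rw [← Real.rpow_natCast, Nat.cast_sub (Finset.card_le_card hKT)]
        exact Real.rpow_le_rpow_of_exponent_le (by norm_num) (by linarith)
    _ ≤ 𝒳.card * (2 : ℝ) ^ (γ * g) := by
        rw [Finset.sum_const, nsmul_eq_mul]
        gcongr
        exact Finset.filter_subset _ _
    _ ≤ _ := by
        gcongr
        exact_mod_cast h𝒳card

end Towers

section Polymers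

/-- Homomorphisms to `ℤ` that are even exactly at the even vertices. -/
structure IsGood (f : (Fin d → Bool) → ℤ) : Prop where
  hom : ∀ x i, |f x - f (flipAt i x)| = 1
  even_iff : ∀ x, Even (f x) ↔ Even (wt x)

/-- The even vertices at which `f` does not vanish. -/
def supp (f : (Fin d → Bool) → ℤ) : Finset (Fin d → Bool) :=
  Finset.univ.filter fun x => Even (wt x) ∧ f x ≠ 0

/-- The neighbourhood of a set of vertices. -/
def nbhd (S : Finset (Fin d → Bool)) : Finset (Fin d → Bool) :=
  Finset.univ.filter fun x => ∃ i, flipAt i x ∈ S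

/-- Two elements of `S` having a common neighbour. -/
def LinkIn (S : Finset (Fin d → Bool)) (x y : Fin d → Bool) : Prop :=
  x ∈ S ∧ y ∈ S ∧ ∃ i j, flipAt i (flipAt j x) = y

open Classical in
/-- The `LinkIn`-component of `v` in `A`. -/
noncomputable def comp (A : Finset (Fin d → Bool)) (v : Fin d → Bool) :
    Finset (Fin d → Bool) :=
  A.filter fun w => Relation.ReflTransGen (LinkIn A) v w

/-- The function equal to `f` on `P` and its neighbourhood, and constant on each parity class
elsewhere. -/
def restrict (f : (Fin d → Bool) → ℤ) (P : Finset (Fin d → Bool)) : (Fin d → Bool) → ℤ :=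
  fun x => if x ∈ P ∨ x ∈ nbhd P then f x else if Even (wt x) then 0 else 1

/-- Good functions whose support is nonempty and linked, equal to `1` at the odd vertices away
from the support. -/
structure IsPolymer (h : (Fin d → Bool) → ℤ) : Prop extends IsGood h where
  nonempty : (supp h).Nonempty
  linked : ∀ x ∈ supp h, ∀ y ∈ supp h, Relation.ReflTransGen (LinkIn (supp h)) x y
  eq_one : ∀ x, ¬ Even (wt x) → x ∉ nbhd (supp h) → h x = 1

/-- The restrictions of `f` to the components of its support. -/
noncomputable def polymers (f : (Fin d → Bool) → ℤ) : Finset ((Fin d → Bool) → ℤ) :=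
  (supp f).image fun v => restrict f (comp (supp f) v)

lemma mem_supp {f : (Fin d → Bool) → ℤ} {x : Fin d → Bool} :
    x ∈ supp f ↔ Even (wt x) ∧ f x ≠ 0 := by simp [supp]

lemma mem_nbhd {S : Finset (Fin d → Bool)} {x : Fin d → Bool} :
    x ∈ nbhd S ↔ ∃ i, flipAt i x ∈ S := by simp [nbhd]

lemma not_even_of_mem_nbhd_supp {f : (Fin d → Bool) → ℤ} {x : Fin d → Bool}
    (hx : x ∈ nbhd (supp f)) : ¬ Even (wt x) := by
  obtain ⟨i, hi⟩ := mem_nbhd.1 hx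
  rw [← even_wt_flipAt i]
  exact (mem_supp.1 hi).1

lemma nbhd_mono {S T : Finset (Fin d → Bool)} (h : S ⊆ T) : nbhd S ⊆ nbhd T := fun x hx => by
  obtain ⟨i, hi⟩ := mem_nbhd.1 hx
  exact mem_nbhd.2 ⟨i, h hi⟩

lemma LinkIn.symm {S : Finset (Fin d → Bool)} {x y : Fin d → Bool} (h : LinkIn S x y) :
    LinkIn S y x := by
  obtain ⟨hx, hy, i, j, rfl⟩ := h
  exact ⟨hy, hx, j, i, by simp [flipAt_flipAt]⟩

lemma reflTransGen_linkIn_symm {S : Finset (Fin d → Bool)} {x y : Fin d → Bool}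
    (h : Relation.ReflTransGen (LinkIn S) x y) : Relation.ReflTransGen (LinkIn S) y x := by
  induction h with
  | refl => exact .refl
  | tail _ hbc ih => exact .head hbc.symm ih

lemma mem_comp {A : Finset (Fin d → Bool)} {v w : Fin d → Bool} :
    w ∈ comp A v ↔ w ∈ A ∧ Relation.ReflTransGen (LinkIn A) v w := by simp [comp]

lemma comp_subset (A : Finset (Fin d → Bool)) (v : Fin d → Bool) : comp A v ⊆ A :=
  fun _ hw => (mem_comp.1 hw).1

lemma mem_comp_of_linkIn {A : Finset (Fin d → Bool)} {v w y : Fin d → Bool}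
    (hw : w ∈ comp A v) (h : LinkIn A w y) : y ∈ comp A v :=
  mem_comp.2 ⟨h.2.1, (mem_comp.1 hw).2.tail h⟩

lemma comp_eq_of_mem {A : Finset (Fin d → Bool)} {v w : Fin d → Bool} (hw : w ∈ comp A v) :
    comp A w = comp A v := by
  have hvw := (mem_comp.1 hw).2
  ext y
  simp only [mem_comp, and_congr_right_iff]
  exact fun _ => ⟨fun h => hvw.trans h, fun h => (reflTransGen_linkIn_symm hvw).trans h⟩

lemma comp_linked {A : Finset (Fin d → Bool)} {v x y : Fin d → Bool}
    (hx : x ∈ comp A v) (hy : y ∈ comp A v) :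
    Relation.ReflTransGen (LinkIn (comp A v)) x y := by
  have key {w} (hw : Relation.ReflTransGen (LinkIn A) v w) :
      Relation.ReflTransGen (LinkIn (comp A v)) v w := by
    induction hw with
    | refl => exact .refl
    | tail hab hbc ih =>
      have hb := mem_comp.2 ⟨hbc.1, hab⟩
      exact ih.tail ⟨hb, mem_comp_of_linkIn hb hbc, hbc.2.2⟩
  exact (reflTransGen_linkIn_symm (key (mem_comp.1 hx).2)).trans (key (mem_comp.1 hy).2)

lemma comp_eq_of_mem_nbhd {A : Finset (Fin d → Bool)} {v w x : Fin d → Bool}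
    (hv : x ∈ nbhd (comp A v)) (hw : x ∈ nbhd (comp A w)) : comp A v = comp A w := by
  obtain ⟨i, hi⟩ := mem_nbhd.1 hv
  obtain ⟨j, hj⟩ := mem_nbhd.1 hw
  have h : flipAt j x ∈ comp A v := mem_comp_of_linkIn hi
    ⟨comp_subset _ _ hi, comp_subset _ _ hj, j, i, by rw [flipAt_flipAt]⟩
  rw [← comp_eq_of_mem h, comp_eq_of_mem hj]

section Restrict

variable {f : (Fin d → Bool) → ℤ} {v : Fin d → Bool}

lemma even_of_mem_comp {x : Fin d → Bool} (hx : x ∈ comp (supp f) v) : Even (wt x) :=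
  (mem_supp.1 (comp_subset _ _ hx)).1

lemma notMem_nbhd_comp {x : Fin d → Bool} (hx : Even (wt x)) : x ∉ nbhd (comp (supp f) v) :=
  fun h => not_even_of_mem_nbhd_supp (nbhd_mono (comp_subset _ _) h) hx

lemma supp_restrict : supp (restrict f (comp (supp f) v)) = comp (supp f) v := by
  ext x
  rw [mem_supp]
  constructor
  · rintro ⟨hx, hne⟩
    by_contra hxP
    simp [restrict, hxP, notMem_nbhd_comp hx, hx] at hne
  · intro hx
    refine ⟨even_of_mem_comp hx, ?_⟩
    simpa [restrict, hx] using (mem_supp.1 (comp_subset _ _ hx)).2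

lemma IsGood.isPolymer_restrict (hf : IsGood f) (hv : v ∈ supp f) :
    IsPolymer (restrict f (comp (supp f) v)) := by
  have hev {x} (hx : Even (wt x)) (i) : |restrict f (comp (supp f) v) x -
      restrict f (comp (supp f) v) (flipAt i x)| = 1 := by
    have hodd : ¬ Even (wt (flipAt i x)) := by rw [even_wt_flipAt]; tauto
    by_cases hxP : x ∈ comp (supp f) v
    · have hu : flipAt i x ∈ nbhd (comp (supp f) v) :=
        mem_nbhd.2 ⟨i, by rwa [flipAt_flipAt]⟩
      simpa [restrict, hxP, hu] using hf.hom x i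
    · have hx' : restrict f (comp (supp f) v) x = 0 := by
        simp [restrict, hxP, notMem_nbhd_comp hx, hx]
      rw [hx']
      by_cases hu : flipAt i x ∈ nbhd (comp (supp f) v)
      · have hfx : f x = 0 := by
          by_contra hne
          obtain ⟨j, hj⟩ := mem_nbhd.1 hu
          refine hxP (mem_comp_of_linkIn hj ⟨comp_subset _ _ hj, mem_supp.2 ⟨hx, hne⟩, i, j, ?_⟩)
          simp [flipAt_flipAt]
        have := hf.hom x i
        rw [hfx] at this
        simpa [restrict, hu] using this
      · have huP : flipAt i x ∉ comp (supp f) v := fun h => hodd (even_of_mem_comp h)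
        simp [restrict, hu, huP, hodd]
  refine ⟨⟨fun x i => ?_, fun x => ?_⟩, ?_, ?_, ?_⟩
  · by_cases hx : Even (wt x)
    · exact hev hx i
    · have := hev ((even_wt_flipAt i x).2 hx) i
      rwa [flipAt_flipAt, abs_sub_comm] at this
  · unfold restrict
    split_ifs with h1 h2
    · exact hf.even_iff x
    · simpa using h2
    · simpa using h2
  · rw [supp_restrict]
    exact ⟨v, mem_comp.2 ⟨hv, .refl⟩⟩
  · rw [supp_restrict]
    exact fun x hx y hy => comp_linked hx hy
  · rw [supp_restrict]
    intro x hx hxn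
    have hxP : x ∉ comp (supp f) v := fun h => hx (even_of_mem_comp h)
    simp [restrict, hxP, hxn, hx]

end Restrict

lemma eq_of_mem_polymers {f h : (Fin d → Bool) → ℤ} (hh : h ∈ polymers f) {x : Fin d → Bool}
    (hx : x ∈ supp h ∨ x ∈ nbhd (supp h)) : f x = h x := by
  obtain ⟨v, -, rfl⟩ := Finset.mem_image.1 hh
  rw [supp_restrict] at hx
  simp [restrict, hx]

lemma exists_mem_polymers {f : (Fin d → Bool) → ℤ} {x : Fin d → Bool} (hx : x ∈ supp f) :
    ∃ h ∈ polymers f, x ∈ supp h :=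
  ⟨_, Finset.mem_image_of_mem _ hx, by rw [supp_restrict]; exact mem_comp.2 ⟨hx, .refl⟩⟩

lemma pairwiseDisjoint_nbhd_supp (f : (Fin d → Bool) → ℤ) :
    (polymers f : Set ((Fin d → Bool) → ℤ)).PairwiseDisjoint fun h => nbhd (supp h) := by
  intro h hh h' hh' hne
  obtain ⟨v, -, rfl⟩ := Finset.mem_image.1 (Finset.mem_coe.1 hh)
  obtain ⟨w, -, rfl⟩ := Finset.mem_image.1 (Finset.mem_coe.1 hh')
  simp only [Function.onFun, supp_restrict]
  rw [Finset.disjoint_left]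
  intro x hv hw
  exact hne (by rw [comp_eq_of_mem_nbhd hv hw])

/-- The number of functions with given polymers. -/
lemma card_fiber_polymers_le (hd : 1 ≤ d) {𝓕 : Finset ((Fin d → Bool) → ℤ)}
    (h𝓕 : ∀ f ∈ 𝓕, IsGood f) (𝓗 : Finset ((Fin d → Bool) → ℤ)) :
    ((𝓕.filter fun f => polymers f = 𝓗).card : ℝ) ≤
      2 ^ 2 ^ (d - 1) * ∏ h ∈ 𝓗, (1 / 2 : ℝ) ^ (nbhd (supp h)).card := by
  rcases (𝓕.filter fun f => polymers f = 𝓗).eq_empty_or_nonempty with h0 | ⟨f₀, hf₀⟩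
  · rw [h0]
    simp only [Finset.card_empty, Nat.cast_zero]
    positivity
  obtain rfl := (Finset.mem_filter.1 hf₀).2
  set O : Finset (Fin d → Bool) := Finset.univ.filter fun x => ¬ Even (wt x) with hO
  set B := (polymers f₀).biUnion fun h => nbhd (supp h) with hB
  have hBO : B ⊆ O := by
    intro x hx
    obtain ⟨h, -, hxh⟩ := Finset.mem_biUnion.1 hx
    simpa [hO] using not_even_of_mem_nbhd_supp hxh
  have hOcard : O.card = 2 ^ (d - 1) := by
    have h1 : 2 * O.card = 2 ^ d := (two_mul_card_even hd).2
    have h2 : 2 ^ d = 2 * 2 ^ (d - 1) := by rw [← pow_succ', Nat.sub_add_cancel hd]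
    omega
  have hBcard : B.card = ∑ h ∈ polymers f₀, (nbhd (supp h)).card :=
    Finset.card_biUnion (pairwiseDisjoint_nbhd_supp f₀)
  have hsdiff : (O \ B).card + B.card = 2 ^ (d - 1) := by
    rw [Finset.card_sdiff_add_card_eq_card hBO, hOcard]
  have hinj : (𝓕.filter fun f => polymers f = polymers f₀).card ≤ (O \ B).powerset.card := by
    refine Finset.card_le_card_of_injOn (fun f => (O \ B).filter fun x => f x = 1)
      (fun f _ => Finset.mem_coe.2 (Finset.mem_powerset.2 (Finset.filter_subset _ _))) ?_
    intro f hf f' hf' hff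
    have hf := Finset.mem_filter.1 (Finset.mem_coe.1 hf)
    have hf' := Finset.mem_filter.1 (Finset.mem_coe.1 hf')
    funext x
    by_cases hx : ∃ h ∈ polymers f₀, x ∈ supp h ∨ x ∈ nbhd (supp h)
    · obtain ⟨h, hh, hxh⟩ := hx
      rw [eq_of_mem_polymers (f := f) (hf.2.symm ▸ hh) hxh,
        eq_of_mem_polymers (f := f') (hf'.2.symm ▸ hh) hxh]
    · have hzero {g} (hg : polymers g = polymers f₀) {y} (hy : Even (wt y))
          (hyx : y = x ∨ ∃ i, flipAt i x = y) : g y = 0 := by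
        by_contra hne
        obtain ⟨h, hh, hyh⟩ := exists_mem_polymers (mem_supp.2 ⟨hy, hne⟩)
        refine hx ⟨h, hg ▸ hh, ?_⟩
        rcases hyx with rfl | ⟨i, rfl⟩
        · exact Or.inl hyh
        · exact Or.inr (mem_nbhd.2 ⟨i, hyh⟩)
      by_cases hev : Even (wt x)
      · rw [hzero hf.2 hev (Or.inl rfl), hzero hf'.2 hev (Or.inl rfl)]
      · have hev' := (even_wt_flipAt ⟨0, hd⟩ x).2 hev
        have h1 := (h𝓕 f hf.1).hom x ⟨0, hd⟩
        have h2 := (h𝓕 f' hf'.1).hom x ⟨0, hd⟩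
        rw [hzero hf.2 hev' (Or.inr ⟨_, rfl⟩), sub_zero] at h1
        rw [hzero hf'.2 hev' (Or.inr ⟨_, rfl⟩), sub_zero] at h2
        have hxU : x ∈ O \ B := by
          simp only [hO, hB, Finset.mem_sdiff, Finset.mem_filter, Finset.mem_univ, true_and,
            Finset.mem_biUnion]
          refine ⟨hev, ?_⟩
          rintro ⟨h, hh, hxh⟩
          exact hx ⟨h, hh, Or.inr hxh⟩
        have h3 := Finset.ext_iff.1 hff x
        simp only [Finset.mem_filter, hxU, true_and] at h3
        rcases eq_or_eq_neg_of_abs_eq h1 with h1 | h1 <;>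
        rcases eq_or_eq_neg_of_abs_eq h2 with h2 | h2 <;> omega
  rw [Finset.card_powerset] at hinj
  rw [Finset.prod_pow_eq_pow_sum, ← hBcard, ← hsdiff, pow_add, mul_assoc, ← mul_pow]
  norm_num
  exact_mod_cast hinj

/-- Polymer expansion. -/
theorem card_le_exp_sum_polymers (hd : 1 ≤ d) {𝓕 𝒬 : Finset ((Fin d → Bool) → ℤ)}
    (h𝓕 : ∀ f ∈ 𝓕, IsGood f) (h𝒬 : ∀ f ∈ 𝓕, polymers f ⊆ 𝒬) :
    (𝓕.card : ℝ) ≤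
      2 ^ 2 ^ (d - 1) * Real.exp (∑ h ∈ 𝒬, (1 / 2 : ℝ) ^ (nbhd (supp h)).card) := by
  rw [Finset.card_eq_sum_card_fiberwise (f := polymers) (t := 𝒬.powerset)
    (fun f hf => Finset.mem_coe.2 (Finset.mem_powerset.2 (h𝒬 f hf)))]
  push_cast
  refine (Finset.sum_le_sum fun 𝓗 _ => card_fiber_polymers_le hd h𝓕 𝓗).trans ?_
  rw [← Finset.mul_sum, ← Finset.prod_one_add, Real.exp_sum]
  gcongr with h _
  rw [add_comm]
  exact Real.add_one_le_exp _

end Polymers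

section PolymerTowers

/-- The tower of a function. -/
noncomputable def tower (h : (Fin d → Bool) → ℤ) : Finset ((Fin d → Bool) × ℤ) :=
  Finset.univ.biUnion fun x =>
    ((Finset.Icc 2 |h x|).filter fun j => Even j ↔ Even (wt x)).image fun j => (x, j)

lemma mem_tower {h : (Fin d → Bool) → ℤ} {p : (Fin d → Bool) × ℤ} :
    p ∈ tower h ↔ 2 ≤ p.2 ∧ p.2 ≤ |h p.1| ∧ (Even p.2 ↔ Even (wt p.1)) := by
  obtain ⟨x, j⟩ := p
  simp [tower, and_assoc]

lemma card_le_card_nbhd (hd : 1 ≤ d) (S : Finset (Fin d → Bool)) : S.card ≤ (nbhd S).card :=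
  Finset.card_le_card_of_injOn (flipAt ⟨0, hd⟩)
    (fun x hx => Finset.mem_coe.2 (mem_nbhd.2 ⟨⟨0, hd⟩, by rwa [flipAt_flipAt]⟩))
    (flipAt_injective _).injOn

lemma card_nbhd_le (S : Finset (Fin d → Bool)) : (nbhd S).card ≤ S.card * d := by
  have : nbhd S ⊆ S.biUnion fun x => Finset.univ.image fun i => flipAt i x := by
    intro x hx
    obtain ⟨i, hi⟩ := mem_nbhd.1 hx
    exact Finset.mem_biUnion.2 ⟨_, hi, Finset.mem_image.2 ⟨i, Finset.mem_univ _, flipAt_flipAt _ _⟩⟩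
  refine (Finset.card_le_card this).trans (Finset.card_biUnion_le_card_mul _ _ _ fun x _ => ?_)
  simpa using Finset.card_image_le (s := (Finset.univ : Finset (Fin d)))
    (f := fun i => flipAt i x)

lemma card_image_flipAt (x : Fin d → Bool) :
    (Finset.univ.image fun i => flipAt i x).card = d := by
  rw [Finset.card_image_of_injective _ (flipAt_left_injective x), Finset.card_univ,
    Fintype.card_fin]

lemma image_flipAt_subset_nbhd {S : Finset (Fin d → Bool)} {x : Fin d → Bool} (hx : x ∈ S) :
    (Finset.univ.image fun i => flipAt i x) ⊆ nbhd S := by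
  intro y hy
  obtain ⟨i, -, rfl⟩ := Finset.mem_image.1 hy
  exact mem_nbhd.2 ⟨i, by rwa [flipAt_flipAt]⟩

lemma two_mul_le_card_nbhd_add_two {S : Finset (Fin d → Bool)} (hS : 1 < S.card) :
    2 * d ≤ (nbhd S).card + 2 := by
  obtain ⟨v, hv, w, hw, hvw⟩ := Finset.one_lt_card.1 hS
  obtain ⟨k, hk⟩ := Function.ne_iff.1 hvw
  have hinter : (Finset.univ.image fun i => flipAt i v) ∩ (Finset.univ.image fun i => flipAt i w)
      ⊆ {flipAt k v, flipAt k w} := by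
    intro x hx
    simp only [Finset.mem_inter, Finset.mem_image, Finset.mem_univ, true_and] at hx
    obtain ⟨⟨i, rfl⟩, j, hj⟩ := hx
    by_cases hi : k = i
    · simp [hi]
    by_cases hj' : k = j
    · simp [← hj, hj']
    · have := congrFun hj k
      rw [flipAt_apply_of_ne hj', flipAt_apply_of_ne hi] at this
      exact absurd this.symm hk
  have h1 := Finset.card_union_add_card_inter (Finset.univ.image fun i => flipAt i v)
    (Finset.univ.image fun i => flipAt i w)
  rw [card_image_flipAt, card_image_flipAt] at h1
  have h2 := Finset.card_le_card (Finset.union_subset (image_flipAt_subset_nbhd hv)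
    (image_flipAt_subset_nbhd hw))
  have h3 := (Finset.card_le_card hinter).trans Finset.card_le_two
  omega

lemma IsGood.two_le_abs {h : (Fin d → Bool) → ℤ} (hh : IsGood h) {x : Fin d → Bool}
    (hx : x ∈ supp h) : 2 ≤ |h x| := by
  obtain ⟨hev, hne⟩ := mem_supp.1 hx
  obtain ⟨k, hk⟩ := (hh.even_iff x).2 hev
  rw [abs_eq_max_neg]
  omega

lemma IsGood.one_le_abs {h : (Fin d → Bool) → ℤ} (hh : IsGood h) {x : Fin d → Bool}
    (hx : ¬ Even (wt x)) : 1 ≤ |h x| := by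
  rw [← hh.even_iff] at hx
  by_contra! hlt
  rw [Int.abs_lt_one_iff.1 hlt] at hx
  simp at hx

lemma IsGood.abs_le_abs_flipAt {h : (Fin d → Bool) → ℤ} (hh : IsGood h) (x : Fin d → Bool)
    (i : Fin d) : |h x| ≤ |h (flipAt i x)| + 1 := by
  have := hh.hom x i
  simp only [abs_eq_max_neg] at *
  omega

lemma IsPolymer.isTower {h : (Fin d → Bool) → ℤ} (hh : IsPolymer h) (hd : 1 ≤ d) :
    IsTower (nbhd (supp h)).card (tower h) := by
  have hsupp {x : Fin d → Bool} (hx : Even (wt x)) (h2 : 2 ≤ |h x|) : x ∈ supp h :=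
    mem_supp.2 ⟨hx, fun h0 => by rw [h0] at h2; simp at h2⟩
  have hslice (j : ℤ) (S : Finset ((Fin d → Bool) × ℤ)) (R : Finset (Fin d → Bool))
      (hR : ∀ p ∈ S, p.2 = j → p.1 ∈ R) : (S.filter fun p => p.2 = j).card ≤ R.card := by
    refine Finset.card_le_card_of_injOn Prod.fst ?_ ?_
    · intro p hp
      have hp := Finset.mem_filter.1 (Finset.mem_coe.1 hp)
      exact hR p hp.1 hp.2
    · intro p hp q hq hpq
      have hp := Finset.mem_filter.1 (Finset.mem_coe.1 hp)
      have hq := Finset.mem_filter.1 (Finset.mem_coe.1 hq)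
      exact Prod.ext hpq (hp.2.trans hq.2.symm)
  refine ⟨fun p hp => (mem_tower.1 hp).1, fun p hp => (mem_tower.1 hp).2.2, ?_, ?_, ?_, ?_, ?_⟩
  · intro p hp h3 q hq
    obtain ⟨i, rfl⟩ := mem_lower.1 hq
    obtain ⟨-, hp2, hp3⟩ := mem_tower.1 hp
    have := hh.abs_le_abs_flipAt p.1 i
    refine mem_tower.2 ⟨by simp only; omega, by simp only; omega, ?_⟩
    simp only [even_wt_flipAt, Int.even_sub_one, hp3]
  · intro j
    by_cases hj : Even j
    · refine (hslice j _ (supp h) ?_).trans (card_le_card_nbhd hd _)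
      rintro p hp rfl
      obtain ⟨hp1, hp2, hp3⟩ := mem_tower.1 hp
      exact hsupp (hp3.1 hj) (hp1.trans hp2)
    · refine hslice j _ _ ?_
      rintro p hp rfl
      obtain ⟨hp1, hp2, hp3⟩ := mem_tower.1 hp
      have := hh.abs_le_abs_flipAt p.1 ⟨0, hd⟩
      refine mem_nbhd.2 ⟨⟨0, hd⟩, hsupp ((even_wt_flipAt _ _).2 fun he => hj (hp3.2 he)) ?_⟩
      have : p.2 ≠ 2 := fun he => hj (by simp [he])
      omega
  · refine hslice 1 _ _ ?_
    intro p hp hp1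
    obtain ⟨q, hq, hpq⟩ := Finset.mem_biUnion.1 hp
    obtain ⟨i, rfl⟩ := mem_lower.1 hpq
    obtain ⟨hq1, hq2, hq3⟩ := mem_tower.1 hq
    simp only at hp1
    have hq22 : q.2 = 2 := by omega
    refine mem_nbhd.2 ⟨i, ?_⟩
    simp only [flipAt_flipAt]
    exact hsupp (hq3.1 (by simp [hq22])) (hq1.trans hq2)
  · obtain ⟨x, hx⟩ := hh.nonempty
    exact ⟨(x, 2), mem_tower.2 ⟨le_rfl, hh.two_le_abs hx, by simpa using (mem_supp.1 hx).1⟩⟩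
  · have hlift {x : Fin d → Bool} (hx : x ∈ supp h) : (x, (2 : ℤ)) ∈ tower h :=
      mem_tower.2 ⟨le_rfl, hh.two_le_abs hx, by simpa using (mem_supp.1 hx).1⟩
    have hmem (p) (hp : p ∈ tower h) (hp2 : p.2 = 2) : p.1 ∈ supp h := by
      obtain ⟨hp1, hp2', hp3⟩ := mem_tower.1 hp
      exact hsupp (hp3.1 (by simp [hp2])) (hp1.trans hp2')
    rintro ⟨x, j⟩ hx ⟨y, k⟩ hy rfl rfl
    refine Relation.ReflTransGen.lift (fun x => (x, (2 : ℤ))) ?_ _ _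
      (hh.linked x (hmem _ hx rfl) y (hmem _ hy rfl))
    rintro a b ⟨-, hb, i, j, hij⟩
    exact ⟨hlift hb, mem_near.2 ⟨i, j, by simp [hij]⟩⟩

lemma IsPolymer.pos_iff_pos {h : (Fin d → Bool) → ℤ} (hh : IsPolymer h) {x y : Fin d → Bool}
    (hx : x ∈ supp h) (hy : y ∈ supp h) : 0 < h x ↔ 0 < h y := by
  have := hh.linked x hx y hy
  induction this with
  | refl => rfl
  | @tail b c _ hbc ih =>
    obtain ⟨hb, hc, i, j, hij⟩ := hbc
    refine (ih hb).trans ?_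
    have h1 := hh.hom b j
    have h2 := hh.hom (flipAt j b) i
    rw [hij] at h2
    have h3 := hh.two_le_abs hb
    have h4 := hh.two_le_abs hc
    simp only [abs_eq_max_neg] at h1 h2 h3 h4
    omega

/-- The sign of a polymer on its support. -/
noncomputable def sign (h : (Fin d → Bool) → ℤ) : Bool := decide (∃ x ∈ supp h, 0 < h x)

lemma IsPolymer.sign_eq_true_iff {h : (Fin d → Bool) → ℤ} (hh : IsPolymer h)
    {x : Fin d → Bool} (hx : x ∈ supp h) : sign h = true ↔ 0 < h x := by
  simp only [sign, decide_eq_true_eq]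
  constructor
  · rintro ⟨y, hy, hpos⟩
    exact (hh.pos_iff_pos hy hx).1 hpos
  · exact fun hpos => ⟨x, hx, hpos⟩

/-- A polymer is determined by its sign and its absolute value. -/
lemma IsPolymer.ext_abs {h h' : (Fin d → Bool) → ℤ} (hh : IsPolymer h) (hh' : IsPolymer h')
    (hsign : sign h = sign h') (habs : ∀ x, |h x| = |h' x|) : h = h' := by
  have hsupp : supp h = supp h' := by
    ext x
    rw [mem_supp, mem_supp, ← abs_ne_zero, habs, abs_ne_zero]
  have hpos {x} (hx : x ∈ supp h) : 0 < h x ↔ 0 < h' x := by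
    rw [← hh.sign_eq_true_iff hx, hsign, hh'.sign_eq_true_iff (hsupp ▸ hx)]
  funext x
  by_cases hx : x ∈ supp h
  · have := hpos hx
    have := hh.two_le_abs hx
    have := habs x
    simp only [abs_eq_max_neg] at *
    omega
  · by_cases hev : Even (wt x)
    · have h0 : h x = 0 := by
        by_contra hne
        exact hx (mem_supp.2 ⟨hev, hne⟩)
      have := habs x
      rw [h0, abs_zero, eq_comm, abs_eq_zero] at this
      rw [h0, this]
    · by_cases hxn : x ∈ nbhd (supp h)
      · obtain ⟨i, hi⟩ := mem_nbhd.1 hxn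
        have h1 := hh.hom x i
        have h2 := hh'.hom x i
        have h3 := hpos hi
        have h4 := hh.two_le_abs hi
        have h5 := habs x
        have h6 := habs (flipAt i x)
        simp only [abs_eq_max_neg] at *
        omega
      · rw [hh.eq_one x hev hxn, hh'.eq_one x hev (hsupp ▸ hxn)]

lemma abs_le_abs_of_tower_subset {h h' : (Fin d → Bool) → ℤ} (hh : IsGood h) (hh' : IsGood h')
    (hsub : tower h ⊆ tower h') (x : Fin d → Bool) : |h x| ≤ |h' x| := by
  by_cases h2 : 2 ≤ |h x|
  · exact (mem_tower.1 (hsub ((mem_tower (p := (x, |h x|))).2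
      ⟨h2, le_rfl, even_abs.trans (hh.even_iff x)⟩))).2.1
  · by_cases hev : Even (wt x)
    · obtain ⟨k, hk⟩ := (hh.even_iff x).2 hev
      simp only [abs_eq_max_neg] at *
      omega
    · have := hh'.one_le_abs hev
      omega

theorem card_polymers_le {γ : ℝ} (hγ0 : 0 < γ) (hγ1 : γ < 1) (hd : 1 ≤ d) {g n : ℕ}
    (hg : 3 * (g : ℝ) ≤ 2 ^ (γ * d)) (hn : 4 * g / ((1 - γ) ^ 2 * d) ≤ (n : ℝ))
    {𝒬 : Finset ((Fin d → Bool) → ℤ)}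
    (h𝒬 : ∀ h ∈ 𝒬, IsPolymer h ∧ (nbhd (supp h)).card = g) :
    (𝒬.card : ℝ) ≤ 2 * (2 ^ d * (3 * d ^ 6) ^ n * (2 : ℝ) ^ (γ * g)) := by
  have h1 : 𝒬.card ≤ ((Finset.univ : Finset Bool) ×ˢ 𝒬.image tower).card := by
    refine Finset.card_le_card_of_injOn (fun h => (sign h, tower h)) ?_ ?_
    · intro h hh
      exact Finset.mem_coe.2 (Finset.mem_product.2 ⟨Finset.mem_univ _,
        Finset.mem_image_of_mem _ hh⟩)
    · intro h hh h' hh' heq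
      have hh := (h𝒬 h hh).1
      have hh' := (h𝒬 h' hh').1
      obtain ⟨h1, h2⟩ := Prod.ext_iff.1 heq
      exact hh.ext_abs hh' h1 fun x => le_antisymm
        (abs_le_abs_of_tower_subset hh.toIsGood hh'.toIsGood h2.le x)
        (abs_le_abs_of_tower_subset hh'.toIsGood hh.toIsGood h2.ge x)
  have h2 : ∀ L ∈ 𝒬.image tower, IsTower g L := by
    intro L hL
    obtain ⟨h, hh, rfl⟩ := Finset.mem_image.1 hL
    obtain ⟨hp, rfl⟩ := h𝒬 h hh
    exact hp.isTower hd
  rw [Finset.card_product, Finset.card_univ, Fintype.card_bool] at h1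
  calc (𝒬.card : ℝ) ≤ 2 * (𝒬.image tower).card := by exact_mod_cast h1
    _ ≤ _ := by
      gcongr
      exact card_towers_le hγ0 hγ1 hd hg hn h2

/-- The polymers supported on a single vertex have total weight at most `1`. -/
lemma sum_singleton_polymers_le (hd : 2 ≤ d) {𝒬 : Finset ((Fin d → Bool) → ℤ)}
    (h𝒬 : ∀ h ∈ 𝒬, IsPolymer h ∧ (supp h).card = 1) :
    ∑ h ∈ 𝒬, (1 / 2 : ℝ) ^ (nbhd (supp h)).card ≤ 1 := by
  set E : Finset (Fin d → Bool) := Finset.univ.filter fun x => Even (wt x) with hE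
  have habs {h : (Fin d → Bool) → ℤ} (hh : IsPolymer h) {v} (hv : supp h = {v}) (x) :
      |h x| = if x = v then 2 else if Even (wt x) then 0 else 1 := by
    have hodd {x} (hx : ¬ Even (wt x)) : |h x| = 1 := by
      obtain ⟨i, hi⟩ : ∃ i, flipAt i x ≠ v := by
        by_contra! hcon
        have := flipAt_left_injective x ((hcon ⟨0, by omega⟩).trans (hcon ⟨1, by omega⟩).symm)
        simp at this
      have h0 : h (flipAt i x) = 0 := by
        by_contra hne
        have : flipAt i x ∈ supp h := mem_supp.2 ⟨(even_wt_flipAt i x).2 hx, hne⟩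
        rw [hv, Finset.mem_singleton] at this
        exact hi this
      simpa [h0] using hh.hom x i
    split_ifs with h1 h2
    · have hxs : x ∈ supp h := by rw [hv, h1]; simp
      have h3 := hh.two_le_abs hxs
      have h4 := hh.abs_le_abs_flipAt x ⟨0, by omega⟩
      rw [hodd (x := flipAt ⟨0, by omega⟩ x)] at h4
      · omega
      · rw [even_wt_flipAt]
        exact not_not.2 (mem_supp.1 hxs).1
    · rw [abs_eq_zero]
      by_contra hne
      have : x ∈ supp h := mem_supp.2 ⟨h2, hne⟩
      rw [hv, Finset.mem_singleton] at this
      exact h1 this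
    · exact hodd h2
  have hcard : 𝒬.card ≤ ((Finset.univ : Finset Bool) ×ˢ
      E.image fun v => ({v} : Finset (Fin d → Bool))).card := by
    refine Finset.card_le_card_of_injOn (fun h => (sign h, supp h)) ?_ ?_
    · intro h hh
      obtain ⟨v, hv⟩ := Finset.card_eq_one.1 (h𝒬 h hh).2
      refine Finset.mem_coe.2 (Finset.mem_product.2 ⟨Finset.mem_univ _, ?_⟩)
      have : v ∈ supp h := by rw [hv]; simp
      exact Finset.mem_image.2 ⟨v, by simpa [hE] using (mem_supp.1 this).1, hv.symm⟩
    · intro h hh h' hh' heq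
      obtain ⟨v, hv⟩ := Finset.card_eq_one.1 (h𝒬 h hh).2
      obtain ⟨h1, h2⟩ := Prod.ext_iff.1 heq
      simp only at h1 h2
      refine (h𝒬 h hh).1.ext_abs (h𝒬 h' hh').1 h1 fun x => ?_
      rw [habs (h𝒬 h hh).1 hv, habs (h𝒬 h' hh').1 (h2 ▸ hv)]
  have hcard' : 𝒬.card ≤ 2 ^ d := by
    refine hcard.trans ?_
    rw [Finset.card_product, Finset.card_univ, Fintype.card_bool]
    refine le_trans (Nat.mul_le_mul_left 2 Finset.card_image_le) ?_
    exact (two_mul_card_even (by omega)).1.le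
  calc ∑ h ∈ 𝒬, (1 / 2 : ℝ) ^ (nbhd (supp h)).card ≤ ∑ h ∈ 𝒬, (1 / 2 : ℝ) ^ d := by
        refine Finset.sum_le_sum fun h hh => ?_
        obtain ⟨v, hv⟩ := Finset.card_eq_one.1 (h𝒬 h hh).2
        refine pow_le_pow_of_le_one (by norm_num) (by norm_num) ?_
        have := Finset.card_le_card
          (image_flipAt_subset_nbhd (S := supp h) (x := v) (by rw [hv]; simp))
        rwa [card_image_flipAt] at this
    _ = 𝒬.card * (1 / 2 : ℝ) ^ d := by rw [Finset.sum_const, nsmul_eq_mul]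
    _ ≤ 2 ^ d * (1 / 2 : ℝ) ^ d := by
        gcongr
        exact_mod_cast hcard'
    _ = 1 := by rw [← mul_pow]; norm_num

end PolymerTowers

section Assembly

lemma eventually_mul_pow_le (C : ℝ) (k : ℕ) {ε : ℝ} (hε : 0 < ε) :
    ∀ᶠ d : ℕ in Filter.atTop, C * (d : ℝ) ^ k ≤ 2 ^ (ε * d) := by
  have hr : (1 : ℝ) < 2 ^ ε := Real.one_lt_rpow (by norm_num) hε
  have h := (isLittleO_pow_const_const_pow_of_one_lt (R := ℝ) k hr).const_mul_left C
  filter_upwards [h.bound one_pos] with d hd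
  rw [one_mul, Real.norm_eq_abs, Real.norm_eq_abs,
    abs_of_nonneg (by positivity : (0 : ℝ) ≤ (2 ^ ε) ^ d),
    ← Real.rpow_mul_natCast (by norm_num)] at hd
  exact (le_abs_self _).trans hd

lemma eventually_card_polymers_mul_le {γ : ℝ} (hγ0 : 0 < γ) (hγ1 : γ < 1) :
    ∀ᶠ d : ℕ in Filter.atTop, ∀ (g : ℕ) (𝒬 : Finset ((Fin d → Bool) → ℤ)),
      3 * (g : ℝ) ≤ 2 ^ (γ * d) →
      (∀ h ∈ 𝒬, IsPolymer h ∧ (nbhd (supp h)).card = g) →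
      (𝒬.card : ℝ) * (1 / 2) ^ g ≤ 2 ^ (1.1 * d + 1 - 0.9 * (1 - γ) * g : ℝ) := by
  have hκ : 0 < 1 - γ := by linarith
  have hκ1 : 1 - γ < 1 := by linarith
  filter_upwards [eventually_mul_pow_le 3 6 (ε := (1 - γ) ^ 3 / 40) (by positivity),
    Filter.eventually_ge_atTop 1] with d hlog hd g 𝒬 hg h𝒬
  have hd0 : (0 : ℝ) < d := by exact_mod_cast hd
  set κ := 1 - γ with hκdef
  set n := ⌈4 * g / (κ ^ 2 * d)⌉₊
  have hn : (n : ℝ) ≤ 4 * g / (κ ^ 2 * d) + 1 := (Nat.ceil_lt_add_one (by positivity)).le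
  have hexp : κ ^ 3 / 40 * d * n ≤ κ * g / 10 + d / 10 := by
    calc κ ^ 3 / 40 * d * n ≤ κ ^ 3 / 40 * d * (4 * g / (κ ^ 2 * d) + 1) := by gcongr
      _ = κ * g / 10 + κ ^ 3 * (d / 40) := by field_simp; ring
      _ ≤ κ * g / 10 + 1 * (d / 10) := by
          gcongr
          · exact pow_le_one₀ hκ.le hκ1.le
          · norm_num
      _ = _ := by ring
  have hpow : (3 * (d : ℝ) ^ 6) ^ n ≤ 2 ^ (κ * g / 10 + d / 10) := by
    calc (3 * (d : ℝ) ^ 6) ^ n ≤ (2 ^ (κ ^ 3 / 40 * d)) ^ n := by gcongr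
      _ = 2 ^ (κ ^ 3 / 40 * d * n) := by rw [← Real.rpow_mul_natCast (by norm_num)]
      _ ≤ _ := Real.rpow_le_rpow_of_exponent_le (by norm_num) hexp
  have hhalf : (1 / 2 : ℝ) ^ g = 2 ^ (-(g : ℝ)) := by
    rw [Real.rpow_neg (by norm_num), Real.rpow_natCast, one_div, inv_pow]
  calc (𝒬.card : ℝ) * (1 / 2) ^ g
      ≤ 2 * (2 ^ d * (3 * d ^ 6) ^ n * (2 : ℝ) ^ (γ * g)) * (1 / 2) ^ g := by
        gcongr
        exact card_polymers_le hγ0 hγ1 hd hg (Nat.le_ceil _) h𝒬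
    _ ≤ 2 ^ (1 : ℝ) * (2 ^ (d : ℝ) * 2 ^ (κ * g / 10 + d / 10) * (2 : ℝ) ^ (γ * g)) *
        2 ^ (-(g : ℝ)) := by
        rw [hhalf, Real.rpow_one, Real.rpow_natCast]
        gcongr
    _ = 2 ^ (1.1 * d + 1 - 0.9 * κ * g : ℝ) := by
        simp only [← Real.rpow_add (two_pos : (0 : ℝ) < 2)]
        congr 1
        rw [hκdef]
        ring

lemma sum_half_pow_card_nbhd_le {𝒬 : Finset ((Fin d → Bool) → ℤ)} {M B : ℝ} (hM : 0 ≤ M)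
    (hB : 0 ≤ B)
    (h𝒬 : ∀ h ∈ 𝒬, 1 ≤ (nbhd (supp h)).card ∧ ((nbhd (supp h)).card : ℝ) ≤ M)
    (hterm : ∀ h ∈ 𝒬, ((𝒬.filter fun k => (nbhd (supp k)).card = (nbhd (supp h)).card).card : ℝ) *
      (1 / 2) ^ (nbhd (supp h)).card ≤ B) :
    ∑ h ∈ 𝒬, (1 / 2 : ℝ) ^ (nbhd (supp h)).card ≤ M * B := by
  set G : ((Fin d → Bool) → ℤ) → ℕ := fun h => (nbhd (supp h)).card
  have hcard : ((𝒬.image G).card : ℝ) ≤ M := by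
    have hsub : 𝒬.image G ⊆ Finset.Icc 1 ⌊M⌋₊ := by
      intro g hg
      obtain ⟨h, hh, rfl⟩ := Finset.mem_image.1 hg
      exact Finset.mem_Icc.2 ⟨(h𝒬 h hh).1, Nat.le_floor (h𝒬 h hh).2⟩
    have hle := Finset.card_le_card hsub
    rw [Nat.card_Icc, Nat.add_sub_cancel] at hle
    exact (Nat.cast_le.2 hle).trans (Nat.floor_le hM)
  calc ∑ h ∈ 𝒬, (1 / 2 : ℝ) ^ G h
      = ∑ g ∈ 𝒬.image G, ∑ h ∈ 𝒬 with G h = g, (1 / 2 : ℝ) ^ G h :=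
        (Finset.sum_fiberwise_of_maps_to (fun h hh => Finset.mem_image_of_mem G hh) _).symm
    _ ≤ ∑ g ∈ 𝒬.image G, B := by
        refine Finset.sum_le_sum fun g hg => ?_
        obtain ⟨k, hk, rfl⟩ := Finset.mem_image.1 hg
        rw [Finset.sum_congr rfl fun h hh => by rw [(Finset.mem_filter.1 hh).2],
          Finset.sum_const, nsmul_eq_mul]
        exact hterm k hk
    _ ≤ M * B := by
        rw [Finset.sum_const, nsmul_eq_mul]
        gcongr

lemma eventually_sum_polymers_le {γ : ℝ} (hγ0 : 0 < γ) (hγ1 : γ < 1) :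
    ∀ᶠ d : ℕ in Filter.atTop, ∀ 𝒬 : Finset ((Fin d → Bool) → ℤ),
      (∀ h ∈ 𝒬, IsPolymer h ∧ 1 < (supp h).card ∧
        3 * ((nbhd (supp h)).card : ℝ) ≤ 2 ^ (γ * d)) →
      ∑ h ∈ 𝒬, (1 / 2 : ℝ) ^ (nbhd (supp h)).card ≤ 2 ^ (-(d : ℝ) / 4) := by
  filter_upwards [eventually_card_polymers_mul_le hγ0 hγ1,
    eventually_card_polymers_mul_le (γ := 1 / 10) (by norm_num) (by norm_num),
    eventually_mul_pow_le (14 / (1 - γ)) 1 (ε := 1 / 10) (by norm_num),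
    Filter.eventually_ge_atTop 30] with d hlarge hsmall hgrow hd 𝒬 h𝒬
  have hκ : 0 < 1 - γ := by linarith
  have hd30 : (30 : ℝ) ≤ d := by exact_mod_cast hd
  have hone {h} (hh : h ∈ 𝒬) : 2 * d ≤ (nbhd (supp h)).card + 2 :=
    two_mul_le_card_nbhd_add_two (h𝒬 h hh).2.1
  have hS : ∑ h ∈ 𝒬 with 3 * ((nbhd (supp h)).card : ℝ) ≤ 2 ^ (1 / 10 * d : ℝ),
      (1 / 2 : ℝ) ^ (nbhd (supp h)).card ≤ 2 ^ (1 / 10 * d : ℝ) * 2 ^ (3 - 0.52 * d : ℝ) := by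
    refine sum_half_pow_card_nbhd_le (by positivity) (by positivity) (fun h hh => ?_) fun h hh => ?_
    · obtain ⟨hh, hle⟩ := Finset.mem_filter.1 hh
      have := hone hh
      exact ⟨by omega, by linarith [Nat.cast_nonneg (α := ℝ) (nbhd (supp h)).card]⟩
    · obtain ⟨hh, hle⟩ := Finset.mem_filter.1 hh
      refine (hsmall _ _ hle fun k hk => ?_).trans
        (Real.rpow_le_rpow_of_exponent_le (by norm_num) ?_)
      · obtain ⟨hk, hkg⟩ := Finset.mem_filter.1 hk
        exact ⟨(h𝒬 k (Finset.mem_filter.1 hk).1).1, hkg⟩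
      · have : 2 * (d : ℝ) ≤ (nbhd (supp h)).card + 2 := by exact_mod_cast hone hh
        linarith
  have hL : ∑ h ∈ 𝒬 with ¬ 3 * ((nbhd (supp h)).card : ℝ) ≤ 2 ^ (1 / 10 * d : ℝ),
      (1 / 2 : ℝ) ^ (nbhd (supp h)).card ≤ 2 ^ (d : ℝ) * 2 ^ (-1.9 * d : ℝ) := by
    refine sum_half_pow_card_nbhd_le (by positivity) (by positivity) (fun h hh => ?_) fun h hh => ?_
    · obtain ⟨hh, hle⟩ := Finset.mem_filter.1 hh
      have h1 := hone hh
      have h2 : (2 : ℝ) ^ (γ * d) ≤ 2 ^ (d : ℝ) :=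
        Real.rpow_le_rpow_of_exponent_le (by norm_num) (by nlinarith)
      have h3 := (h𝒬 h hh).2.2
      exact ⟨by omega, by linarith [Nat.cast_nonneg (α := ℝ) (nbhd (supp h)).card]⟩
    · obtain ⟨hh, hle⟩ := Finset.mem_filter.1 hh
      refine (hlarge _ _ (h𝒬 h hh).2.2 fun k hk => ?_).trans
        (Real.rpow_le_rpow_of_exponent_le (by norm_num) ?_)
      · obtain ⟨hk, hkg⟩ := Finset.mem_filter.1 hk
        exact ⟨(h𝒬 k (Finset.mem_filter.1 hk).1).1, hkg⟩
      · rw [pow_one, div_mul_eq_mul_div, div_le_iff₀ hκ] at hgrow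
        have := mul_le_mul_of_nonneg_right (not_le.1 hle).le hκ.le
        linarith
  rw [← Finset.sum_filter_add_sum_filter_not 𝒬
    fun h => 3 * ((nbhd (supp h)).card : ℝ) ≤ 2 ^ (1 / 10 * d : ℝ)]
  rw [← Real.rpow_add two_pos] at hS hL
  have hS' := hS.trans (Real.rpow_le_rpow_of_exponent_le (z := -(d : ℝ) / 4 - 1)
    one_le_two (by linarith))
  have hL' := hL.trans (Real.rpow_le_rpow_of_exponent_le (z := -(d : ℝ) / 4 - 1)
    one_le_two (by linarith))
  rw [Real.rpow_sub_one (by norm_num)] at hS' hL'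
  linarith

lemma isGood_of_hom {f : (Fin d → Bool) → ℤ}
    (hf : ∀ u v, cubeAdj d u v → |f u - f v| = 1) {x : Fin d → Bool} (hx : Even (wt x))
    (hfx : f x = 0) : IsGood f := by
  have hflip (y) (i) : |f y - f (flipAt i y)| = 1 := hf _ _ (cubeAdj_flipAt i y)
  have hstep (y) (i) (h : Even (f y) ↔ Even (wt y)) :
      Even (f (flipAt i y)) ↔ Even (wt (flipAt i y)) := by
    rw [even_wt_flipAt, ← h]
    rcases eq_or_eq_neg_of_abs_eq (hflip y i) with h1 | h1
    · rw [show f y = f (flipAt i y) + 1 by omega, Int.even_add_one, not_not]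
    · rw [show f (flipAt i y) = f y + 1 by omega, Int.even_add_one]
  refine ⟨hflip, fun y => ?_⟩
  have key (J : Finset (Fin d)) : Even (f fun i => if i ∈ J then y i else x i) ↔
      Even (wt fun i => if i ∈ J then y i else x i) := by
    induction J using Finset.induction_on with
    | empty => simp [hfx, hx]
    | insert j J hj ih =>
      by_cases hxy : x j = y j
      · convert ih using 3 <;> grind
      · have heq : (fun i => if i ∈ insert j J then y i else x i) =
            flipAt j fun i => if i ∈ J then y i else x i := by
          funext i
          rcases eq_or_ne i j with rfl | hij
          · simpa [flipAt_apply_self, hj] using (Bool.eq_not_of_ne (Ne.symm hxy))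
          · simp [flipAt_apply_of_ne hij, hij]
        rw [heq]
        exact hstep _ j ih
  simpa using key Finset.univ

lemma eventually_three_mul_le {α : ℝ} (hα1 : 1 < α) (hα2 : α < 2) :
    ∃ γ : ℝ, 0 < γ ∧ γ < 1 ∧ ∀ᶠ d : ℕ in Filter.atTop, 3 * (d * α ^ d) ≤ 2 ^ (γ * d) := by
  have hα0 : 0 < α := by linarith
  have ha0 : 0 < Real.logb 2 α := Real.logb_pos one_lt_two hα1
  have ha1 : Real.logb 2 α < 1 := by
    rwa [Real.logb_lt_iff_lt_rpow one_lt_two hα0, Real.rpow_one]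
  refine ⟨(1 + Real.logb 2 α) / 2, by linarith, by linarith, ?_⟩
  filter_upwards [eventually_mul_pow_le 3 1 (ε := (1 - Real.logb 2 α) / 2) (by linarith)] with d hd
  calc 3 * (d * α ^ d) = 3 * (d : ℝ) ^ 1 * 2 ^ (Real.logb 2 α * d) := by
        rw [Real.rpow_mul_natCast two_pos.le, Real.rpow_logb two_pos (by norm_num) hα0]
        ring
    _ ≤ 2 ^ ((1 - Real.logb 2 α) / 2 * d) * 2 ^ (Real.logb 2 α * d) := by gcongr
    _ = _ := by
        rw [← Real.rpow_add two_pos]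
        congr 1
        ring

lemma exp_one_add_le (hd : 30 ≤ d) :
    Real.exp (1 + 2 ^ (-(d : ℝ) / 4)) ≤ Real.exp 1 + Real.exp (-(Real.log 2 / 8) * d) := by
  have hd30 : (30 : ℝ) ≤ d := by exact_mod_cast hd
  set δ : ℝ := 2 ^ (-(d : ℝ) / 4) with hδ
  have hδ0 : 0 < δ := by positivity
  have hδ1 : δ ≤ 1 := Real.rpow_le_one_of_one_le_of_nonpos one_le_two (by linarith)
  have h1 : Real.exp δ ≤ 1 + 2 * δ := by
    have := Real.abs_exp_sub_one_le (x := δ) (by rwa [abs_of_pos hδ0])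
    rw [abs_of_pos hδ0] at this
    linarith [le_abs_self (Real.exp δ - 1)]
  have h2 : Real.exp (-(Real.log 2 / 8) * d) = 2 ^ (-(d : ℝ) / 8) := by
    rw [Real.rpow_def_of_pos two_pos]
    congr 1
    ring
  have h3 : 8 * δ ≤ 2 ^ (-(d : ℝ) / 8) := by
    calc 8 * δ = 2 ^ (3 : ℝ) * 2 ^ (-(d : ℝ) / 4) := by rw [hδ]; norm_num
      _ = 2 ^ (3 + -(d : ℝ) / 4) := by rw [Real.rpow_add two_pos]
      _ ≤ _ := Real.rpow_le_rpow_of_exponent_le one_le_two (by linarith)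
  have he := Real.exp_one_lt_d9
  rw [Real.exp_add, h2]
  nlinarith [Real.exp_pos 1]

lemma card_le_of_mem_FE {α γ : ℝ} (hd : 2 ≤ d) (hα : 3 * (d * α ^ d) ≤ 2 ^ (γ * d))
    (hγ : γ < 1) (hα0 : 0 < α)
    (hsum : ∀ 𝒬 : Finset ((Fin d → Bool) → ℤ),
      (∀ h ∈ 𝒬, IsPolymer h ∧ 1 < (supp h).card ∧
        3 * ((nbhd (supp h)).card : ℝ) ≤ 2 ^ (γ * d)) →
      ∑ h ∈ 𝒬, (1 / 2 : ℝ) ^ (nbhd (supp h)).card ≤ 2 ^ (-(d : ℝ) / 4))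
    {𝓕 : Finset ((Fin d → Bool) → ℤ)} (h𝓕 : ∀ f ∈ 𝓕, f ∈ FE d α) :
    (𝓕.card : ℝ) ≤ 2 ^ 2 ^ (d - 1) * Real.exp (1 + 2 ^ (-(d : ℝ) / 4)) := by
  have hd' : (2 : ℝ) ≤ d := by exact_mod_cast hd
  have hsupp {f} (hf : f ∈ 𝓕) : ((supp f).card : ℝ) < α ^ d := by
    have := (h𝓕 f hf).2
    rw [← Set.ncard_coe_finset]
    convert this using 3
    ext x
    simp [mem_supp, evenV, wt]
  have hαd : 0 < α ^ d := by positivity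
  have hgood : ∀ f ∈ 𝓕, IsGood f := by
    intro f hf
    obtain ⟨x, hx, hfx⟩ : ∃ x, Even (wt x) ∧ f x = 0 := by
      by_contra! hne
      have hcard := (two_mul_card_even (d := d) (by omega)).1
      have hsub : (Finset.univ.filter fun x : Fin d → Bool => Even (wt x)) ⊆ supp f := by
        intro x hx
        have hx := (Finset.mem_filter.1 hx).2
        exact mem_supp.2 ⟨hx, hne x hx⟩
      have h1 := Finset.card_le_card hsub
      have h2 : (2 : ℝ) ^ d ≤ 2 * (supp f).card := by
        exact_mod_cast hcard.ge.trans (Nat.mul_le_mul_left 2 h1)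
      have h3 : (2 : ℝ) ^ (γ * d) ≤ 2 ^ d := by
        rw [← Real.rpow_natCast]
        exact Real.rpow_le_rpow_of_exponent_le one_le_two (by nlinarith)
      nlinarith [hsupp hf]
    exact isGood_of_hom (h𝓕 f hf).1 hx hfx
  have h𝒬 : ∀ h ∈ 𝓕.biUnion polymers, IsPolymer h ∧ ((supp h).card : ℝ) ≤ α ^ d := by
    intro h hh
    obtain ⟨f, hf, hh⟩ := Finset.mem_biUnion.1 hh
    obtain ⟨v, hv, rfl⟩ := Finset.mem_image.1 hh
    refine ⟨(hgood f hf).isPolymer_restrict hv, ?_⟩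
    rw [supp_restrict]
    exact le_trans (by exact_mod_cast Finset.card_le_card (comp_subset _ _)) (hsupp hf).le
  refine (card_le_exp_sum_polymers (by omega) hgood
    fun f hf => Finset.subset_biUnion_of_mem polymers hf).trans ?_
  gcongr
  rw [← Finset.sum_filter_add_sum_filter_not _ fun h => (supp h).card = 1]
  refine add_le_add (sum_singleton_polymers_le hd fun h hh => ?_) (hsum _ fun h hh => ?_)
  · obtain ⟨hh, h1⟩ := Finset.mem_filter.1 hh
    exact ⟨(h𝒬 h hh).1, h1⟩
  · obtain ⟨hh, h1⟩ := Finset.mem_filter.1 hh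
    obtain ⟨hp, hle⟩ := h𝒬 h hh
    have h2 : 1 ≤ (supp h).card := Finset.card_pos.2 hp.nonempty
    refine ⟨hp, by omega, le_trans ?_ hα⟩
    have h3 : ((nbhd (supp h)).card : ℝ) ≤ (supp h).card * d := by exact_mod_cast card_nbhd_le _
    nlinarith

end Assembly

end HammingCube

theorem count_FE (α : ℝ) (hα1 : 1 < α) (hα2 : α < 2) :
    ∃ c > (0:ℝ), ∃ d₀ : ℕ, ∀ d : ℕ, d₀ ≤ d →
      ((FE d α).ncard : ℝ) ≤ (Real.exp 1 + Real.exp (-c * d)) * 2 ^ 2 ^ (d - 1) := by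
  obtain ⟨γ, hγ0, hγ1, hγ⟩ := HammingCube.eventually_three_mul_le hα1 hα2
  obtain ⟨d₀, hd₀⟩ := Filter.eventually_atTop.1 (hγ.and
    ((HammingCube.eventually_sum_polymers_le hγ0 hγ1).and (Filter.eventually_ge_atTop 30)))
  refine ⟨Real.log 2 / 8, by positivity, d₀, fun d hd => ?_⟩
  obtain ⟨h1, h2, hd30⟩ := hd₀ d hd
  rcases (FE d α).finite_or_infinite with hfin | hinf
  · rw [Set.ncard_eq_toFinset_card _ hfin, mul_comm]
    refine (HammingCube.card_le_of_mem_FE (by omega) h1 hγ1 (by linarith) h2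
      fun f hf => (hfin.mem_toFinset).1 hf).trans ?_
    gcongr
    exact HammingCube.exp_one_add_le hd30
  · rw [hinf.ncard, Nat.cast_zero]
    positivity
end

section
/- For every real number α with 1 < α < 2 there exist constants c > 0 and d₀ such that for all integers d ≥ d₀, |F^E_4| ≥ (2√e − 2 − e^{−cd})·2^{2^{d−1}}. -/
open Finset Filter Topology

/-- Two adjacent vertices differ by flipping one coordinate. -/
lemma cubeAdj.exists_eq_update {d : ℕ} {u v : Fin d → Bool} (h : cubeAdj d u v) :
    ∃ i, v = Function.update u i (!u i) := by
  obtain ⟨i, hi⟩ := Finset.card_eq_one.1 h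
  refine ⟨i, funext fun j => ?_⟩
  have hj : u j ≠ v j ↔ j = i := by
    simpa using congrArg (j ∈ ·) hi
  by_cases hji : j = i
  · subst hji
    have := hj.2 rfl
    simp only [Function.update_self]
    cases h1 : u j <;> cases h2 : v j <;> simp_all
  · rw [Function.update_of_ne hji]
    by_contra hne
    exact hji (hj.1 (Ne.symm hne))

lemma cubeAdj_update {d : ℕ} (u : Fin d → Bool) (i : Fin d) :
    cubeAdj d u (Function.update u i (!u i)) := by
  refine Finset.card_eq_one.2 ⟨i, ?_⟩
  ext j
  by_cases hji : j = i
  · subst hji; simp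
  · simp [hji]

lemma cubeAdj_comm {d : ℕ} {u v : Fin d → Bool} : cubeAdj d u v ↔ cubeAdj d v u := by
  simp only [cubeAdj, ne_comm]

/-- The finset of even vertices. -/
def evenFinset (d : ℕ) : Finset (Fin d → Bool) :=
  univ.filter fun v => Even (univ.filter fun i => v i = true).card

lemma update_mem_evenFinset {d : ℕ} (u : Fin d → Bool) (i : Fin d) :
    Function.update u i (!u i) ∈ evenFinset d ↔ u ∉ evenFinset d := by
  simp only [evenFinset, mem_filter, mem_univ, true_and]
  cases hu : u i
  · have : (univ.filter fun j => Function.update u i (!false) j = true) =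
        insert i (univ.filter fun j => u j = true) := by
      ext j
      by_cases hji : j = i
      · subst hji; simp
      · simp [hji]
    rw [this, card_insert_of_notMem (by simp [hu]), Nat.even_add_one]
  · have : (univ.filter fun j => u j = true) =
        insert i (univ.filter fun j => Function.update u i (!true) j = true) := by
      ext j
      by_cases hji : j = i
      · subst hji; simp [hu]
      · simp [hji]
    rw [this, card_insert_of_notMem (by simp), Nat.even_add_one, not_not]

lemma cubeAdj.mem_evenFinset_iff {d : ℕ} {u v : Fin d → Bool} (h : cubeAdj d u v) :
    v ∈ evenFinset d ↔ u ∉ evenFinset d := by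
  obtain ⟨i, rfl⟩ := h.exists_eq_update
  exact update_mem_evenFinset u i

lemma card_evenFinset_compl {d : ℕ} (hd : 0 < d) :
    (evenFinset d)ᶜ.card = (evenFinset d).card := by
  let i : Fin d := ⟨0, hd⟩
  refine Finset.card_bij' (fun u _ => Function.update u i (!u i))
    (fun u _ => Function.update u i (!u i)) ?_ ?_ ?_ ?_
  · intro u hu
    exact (update_mem_evenFinset u i).2 (by simpa using hu)
  · intro u hu
    rw [mem_compl, update_mem_evenFinset]
    simpa using hu
  · intro u _; simp
  · intro u _; simp

lemma card_evenFinset {d : ℕ} (hd : 0 < d) : (evenFinset d).card = 2 ^ (d - 1) := by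
  have h1 := card_evenFinset_compl hd
  have h2 := Finset.card_compl_add_card (evenFinset d)
  obtain ⟨k, rfl⟩ : ∃ k, d = k + 1 := ⟨d - 1, by omega⟩
  simp only [Fintype.card_pi, Fintype.card_bool, prod_const, card_univ, Fintype.card_fin,
    pow_succ] at h2
  simp only [Nat.add_sub_cancel]
  omega

/-- The vertices adjacent to some element of `S`. -/
def cubeNbhd {d : ℕ} (S : Finset (Fin d → Bool)) : Finset (Fin d → Bool) :=
  S.biUnion fun u => univ.image fun i => Function.update u i (!u i)

lemma cubeAdj.mem_cubeNbhd {d : ℕ} {S : Finset (Fin d → Bool)} {u v : Fin d → Bool}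
    (h : cubeAdj d u v) (hu : u ∈ S) : v ∈ cubeNbhd S := by
  obtain ⟨i, rfl⟩ := h.exists_eq_update
  exact mem_biUnion.2 ⟨u, hu, mem_image_of_mem _ (mem_univ i)⟩

lemma card_cubeNbhd_le {d : ℕ} (S : Finset (Fin d → Bool)) :
    (cubeNbhd S).card ≤ S.card * d :=
  card_biUnion_le_card_mul _ _ _ fun u _ => card_image_le.trans (by simp)

/-- A function which is `2` on `S`, `-1` on `A`, `0` on the other even vertices and `1` on the
other odd vertices. -/
def flawFun {d : ℕ} (S A : Finset (Fin d → Bool)) (v : Fin d → Bool) : ℤ :=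
  if v ∈ S then 2 else if v ∈ A then -1 else if v ∈ evenFinset d then 0 else 1

section flawFun

variable {d : ℕ} {S A : Finset (Fin d → Bool)}

lemma flawFun_eq_two {v : Fin d → Bool} : flawFun S A v = 2 ↔ v ∈ S := by
  unfold flawFun; split_ifs <;> simp_all

lemma flawFun_eq_neg_one (hSA : Disjoint S A) {v : Fin d → Bool} :
    flawFun S A v = -1 ↔ v ∈ A := by
  have : v ∈ S → v ∉ A := fun h => Finset.disjoint_left.1 hSA h
  unfold flawFun; split_ifs <;> simp_all

lemma flawFun_mem (S A : Finset (Fin d → Bool)) (v : Fin d → Bool) :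
    flawFun S A v ∈ ({-1, 0, 1, 2} : Set ℤ) := by
  unfold flawFun; split_ifs <;> simp

lemma abs_flawFun_sub (hS : S ⊆ evenFinset d) (hA : A ⊆ (evenFinset d)ᶜ \ cubeNbhd S)
    {u v : Fin d → Bool} (h : cubeAdj d u v) : |flawFun S A u - flawFun S A v| = 1 := by
  wlog hu : u ∈ evenFinset d generalizing u v
  · rw [abs_sub_comm]
    exact this (cubeAdj_comm.1 h) (h.mem_evenFinset_iff.2 hu)
  have hv : v ∉ evenFinset d := by
    rw [h.mem_evenFinset_iff]; simpa using hu
  have hvS : v ∉ S := fun h' => hv (hS h')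
  have huA : u ∉ A := fun h' => by simpa [hu] using hA h'
  by_cases huS : u ∈ S
  · have hvA : v ∉ A := fun h' => (mem_sdiff.1 (hA h')).2 (h.mem_cubeNbhd huS)
    simp [flawFun, *]
  · by_cases hvA : v ∈ A <;> simp [flawFun, *]

lemma range_flawFun (hd : 0 < d) (hS : S ⊆ evenFinset d) (hSn : S.Nonempty)
    (hSc : S.card < (evenFinset d).card) (hA : A ⊆ (evenFinset d)ᶜ \ cubeNbhd S)
    (hAn : A.Nonempty) : Set.range (flawFun S A) = {-1, 0, 1, 2} := by
  have hSA : Disjoint S A := Finset.disjoint_left.2 fun v h1 h2 => by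
    simpa [hS h1] using hA h2
  refine subset_antisymm (Set.range_subset_iff.2 (flawFun_mem S A)) ?_
  obtain ⟨s, hs⟩ := hSn
  obtain ⟨a, ha⟩ := hAn
  obtain ⟨z, hz, hzS⟩ := Finset.exists_mem_notMem_of_card_lt_card hSc
  have hzA : z ∉ A := fun h' => by simpa [hz] using hA h'
  have hw := cubeAdj_update s ⟨0, hd⟩
  set w := Function.update s ⟨0, hd⟩ (!s ⟨0, hd⟩)
  have hwE : w ∉ evenFinset d := by rw [hw.mem_evenFinset_iff]; simpa using hS hs
  have hwA : w ∉ A := fun h' => (mem_sdiff.1 (hA h')).2 (hw.mem_cubeNbhd hs)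
  have hwS : w ∉ S := fun h' => hwE (hS h')
  rintro x (rfl | rfl | rfl | rfl)
  · exact ⟨a, (flawFun_eq_neg_one hSA).2 ha⟩
  · exact ⟨z, by simp [flawFun, *]⟩
  · exact ⟨w, by simp [flawFun, *]⟩
  · exact ⟨s, flawFun_eq_two.2 hs⟩

lemma smul_flawFun_mem_FEi (hd : 0 < d) {α : ℝ} (hα : (d : ℝ) < α ^ d)
    (hS : S ⊆ evenFinset d) (hSn : S.Nonempty) (hSd : S.card ≤ d)
    (hSc : S.card < (evenFinset d).card) (hA : A ⊆ (evenFinset d)ᶜ \ cubeNbhd S)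
    (hAn : A.Nonempty) (ε : ℤˣ) : (fun v => (ε : ℤ) * flawFun S A v) ∈ FEi d α 4 := by
  refine ⟨⟨fun u v h => ?_, ?_⟩, ?_⟩
  · rw [← mul_sub, abs_mul, abs_flawFun_sub hS hA h]
    rcases Int.units_eq_one_or ε with rfl | rfl <;> simp
  · have hsub : {v ∈ evenV d | (ε : ℤ) * flawFun S A v ≠ 0} ⊆ (S : Set (Fin d → Bool)) := by
      rintro v ⟨hv, hne⟩
      by_contra hvS
      have hvE : v ∈ evenFinset d := by simpa [evenFinset, evenV] using hv
      have hvA : v ∉ A := fun h' => by simpa [hvE] using hA h'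
      exact hne (by simp_all [flawFun])
    have hle := Set.ncard_le_ncard hsub (finite_toSet S)
    rw [Set.ncard_coe_finset] at hle
    exact lt_of_le_of_lt (by exact_mod_cast hle.trans hSd) hα
  · have : Set.range (fun v => (ε : ℤ) * flawFun S A v) =
        (fun x : ℤ => (ε : ℤ) * x) '' Set.range (flawFun S A) := by
      rw [← Set.range_comp]; rfl
    rw [this, Set.ncard_image_of_injective _ (mul_right_injective₀ ε.ne_zero),
      range_flawFun hd hS hSn hSc hA hAn]
    have : ({-1, 0, 1, 2} : Set ℤ) = (({-1, 0, 1, 2} : Finset ℤ) : Set ℤ) := by simp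
    rw [this, Set.ncard_coe_finset]
    rfl

end flawFun

lemma abs_sub_le_of_adj {d : ℕ} {f : (Fin d → Bool) → ℤ}
    (hf : ∀ u v, cubeAdj d u v → |f u - f v| = 1) (u v : Fin d → Bool) :
    |f u - f v| ≤ d := by
  have key : ∀ s : Finset (Fin d), |f (s.piecewise u v) - f v| ≤ s.card := by
    intro s
    induction s using Finset.induction_on with
    | empty => simp
    | insert i s hi ih =>
      rw [piecewise_insert, card_insert_of_notMem hi]
      set w := s.piecewise u v
      have hstep : |f (Function.update w i (u i)) - f w| ≤ 1 := by
        by_cases hw : u i = w i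
        · rw [hw, Function.update_eq_self]; simp
        · have : u i = !w i := by
            cases h1 : u i <;> cases h2 : w i <;> simp_all
          rw [this, abs_sub_comm]
          exact (hf _ _ (cubeAdj_update w i)).le
      calc |f (Function.update w i (u i)) - f v|
          ≤ |f (Function.update w i (u i)) - f w| + |f w - f v| := abs_sub_le _ _ _
        _ ≤ ((s.card + 1 : ℕ) : ℤ) := by push_cast; linarith
  simpa using key univ

lemma finite_FE {d : ℕ} (hd : 0 < d) {α : ℝ} (hα : α ^ d ≤ 2 ^ (d - 1)) :
    (FE d α).Finite := by
  refine (Set.finite_Icc (fun _ : Fin d → Bool => -(d : ℤ)) (fun _ => (d : ℤ))).subset ?_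
  rintro f ⟨hf, hcard⟩
  obtain ⟨z, hz⟩ : ∃ z, f z = 0 := by
    by_contra! hne
    have : {v ∈ evenV d | f v ≠ 0} = (evenFinset d : Set (Fin d → Bool)) := by
      ext v; simp [hne, evenV, evenFinset]
    rw [this, Set.ncard_coe_finset, card_evenFinset hd] at hcard
    push_cast at hcard
    linarith
  have h := fun v => abs_le.1 (abs_sub_le_of_adj hf v z)
  simp only [hz, sub_zero] at h
  exact ⟨fun v => (h v).1, fun v => (h v).2⟩

/-- Counting the functions `± flawFun S A` with `1 ≤ |S| ≤ d`. -/
lemma sum_choose_le_ncard_FEi {d : ℕ} (hd : 0 < d) (hdN : d < 2 ^ (d - 1)) {α : ℝ}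
    (hα : (d : ℝ) < α ^ d) (hα' : α ^ d ≤ 2 ^ (d - 1)) :
    2 * ∑ t ∈ Icc 1 d, (2 ^ (d - 1)).choose t * (2 ^ (2 ^ (d - 1) - t * d) - 1) ≤
      (FEi d α 4).ncard := by
  classical
  let 𝒮 := (Icc 1 d).biUnion fun t => powersetCard t (evenFinset d)
  let 𝒜 : Finset (Fin d → Bool) → Finset (Finset (Fin d → Bool)) :=
    fun S => ((evenFinset d)ᶜ \ cubeNbhd S).powerset.erase ∅
  let I := (univ : Finset ℤˣ) ×ˢ 𝒮.sigma 𝒜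
  let F : ℤˣ × (Σ _ : Finset (Fin d → Bool), Finset (Fin d → Bool)) → (Fin d → Bool) → ℤ :=
    fun p v => (p.1 : ℤ) * flawFun p.2.1 p.2.2 v
  have hI : ∀ p ∈ I, p.2.1 ⊆ evenFinset d ∧ p.2.1.Nonempty ∧ p.2.1.card ≤ d ∧
      p.2.2 ⊆ (evenFinset d)ᶜ \ cubeNbhd p.2.1 ∧ p.2.2.Nonempty := by
    rintro ⟨ε, S, A⟩ hp
    simp only [I, 𝒮, 𝒜, mem_product, mem_univ, true_and, mem_sigma, mem_biUnion, mem_Icc,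
      mem_powersetCard, mem_erase, mem_powerset] at hp
    obtain ⟨⟨t, ht, hS, hSt⟩, hAn, hA⟩ := hp
    exact ⟨hS, card_pos.1 (by dsimp only; omega), hSt.trans_le ht.2, hA,
      nonempty_iff_ne_empty.2 hAn⟩
  have hinj : Set.InjOn F I := by
    rintro ⟨ε, S, A⟩ hp ⟨ε', S', A'⟩ hp' h
    obtain ⟨hS, hSn, -, hA, -⟩ := hI _ hp
    obtain ⟨hS', -, -, hA', -⟩ := hI _ hp'
    dsimp only at hS hSn hA hS' hA'
    have hv : ∀ v, (ε : ℤ) * flawFun S A v = (ε' : ℤ) * flawFun S' A' v := congrFun h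
    have hε : ε = ε' := by
      obtain ⟨s, hs⟩ := hSn
      have h1 := hv s
      rw [flawFun_eq_two.2 hs] at h1
      have h2 := flawFun_mem S' A' s
      simp only [Set.mem_insert_iff, Set.mem_singleton_iff] at h2
      rcases Int.units_eq_one_or ε with rfl | rfl <;>
        rcases Int.units_eq_one_or ε' with rfl | rfl <;>
        first | rfl | (exfalso; push_cast at h1; omega)
    subst hε
    have hv' : ∀ v, flawFun S A v = flawFun S' A' v := fun v =>
      mul_left_cancel₀ ε.ne_zero (hv v)
    have hSA : Disjoint S A := Finset.disjoint_left.2 fun v h1 h2 => by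
      simpa [hS h1] using hA h2
    have hSA' : Disjoint S' A' := Finset.disjoint_left.2 fun v h1 h2 => by
      simpa [hS' h1] using hA' h2
    have e1 : S = S' := by
      ext v; rw [← flawFun_eq_two (A := A), hv', flawFun_eq_two]
    have e2 : A = A' := by
      ext v; rw [← flawFun_eq_neg_one hSA, hv', flawFun_eq_neg_one hSA']
    rw [e1, e2]
  have himg : ((I.image F : Finset _) : Set ((Fin d → Bool) → ℤ)) ⊆ FEi d α 4 := by
    intro f hf
    obtain ⟨p, hp, rfl⟩ := mem_image.1 (mem_coe.1 hf)
    obtain ⟨hS, hSn, hSd, hA, hAn⟩ := hI p hp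
    exact smul_flawFun_mem_FEi hd hα hS hSn hSd
      (by rw [card_evenFinset hd]; omega) hA hAn p.1
  have hfin : (FEi d α 4).Finite := (finite_FE hd hα').subset fun f hf => hf.1
  have hle := Set.ncard_le_ncard himg hfin
  rw [Set.ncard_coe_finset, card_image_of_injOn hinj] at hle
  refine le_trans ?_ hle
  rw [card_product, card_sigma, sum_biUnion
    (fun i _ j _ hij => pairwise_disjoint_powersetCard _ hij)]
  have h2 : (univ : Finset ℤˣ).card = 2 := rfl
  rw [h2]
  refine Nat.mul_le_mul_left 2 (sum_le_sum fun t _ => ?_)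
  rw [← card_evenFinset hd, ← card_powersetCard, ← smul_eq_mul]
  refine card_nsmul_le_sum _ _ _ fun S hS => ?_
  rw [mem_powersetCard] at hS
  rw [card_erase_of_mem (by simp), card_powerset]
  refine Nat.sub_le_sub_right (Nat.pow_le_pow_right two_pos ?_) 1
  calc (evenFinset d).card - t * d ≤ (evenFinset d)ᶜ.card - (cubeNbhd S).card := by
        rw [card_evenFinset_compl hd]
        have := card_cubeNbhd_le S
        rw [hS.2] at this
        omega
    _ ≤ _ := le_card_sdiff _ _

lemma pow_mul_one_sub_le_choose {N t : ℕ} (hN : 0 < N) (ht : t ≤ N) :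
    (N : ℝ) ^ t / t.factorial * (1 - (t : ℝ) ^ 2 / N) ≤ N.choose t := by
  have hN' : (0 : ℝ) < N := by exact_mod_cast hN
  have htN : (t : ℝ) ≤ N := by exact_mod_cast ht
  have h1 : (N : ℝ) ^ t * (1 - (t : ℝ) ^ 2 / N) ≤ ((N + 1 - t : ℕ) : ℝ) ^ t := by
    have hb := one_add_mul_le_pow (a := -((t : ℝ) / N))
      (by linarith [(div_le_one hN').2 htN]) t
    calc (N : ℝ) ^ t * (1 - (t : ℝ) ^ 2 / N)
        = (N : ℝ) ^ t * (1 + t * -((t : ℝ) / N)) := by ring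
      _ ≤ (N : ℝ) ^ t * (1 + -((t : ℝ) / N)) ^ t := by gcongr
      _ = ((N : ℝ) - t) ^ t := by
        rw [← mul_pow]; congr 1; field_simp; ring
      _ ≤ _ := by
        refine pow_le_pow_left₀ (by linarith) ?_ t
        rw [Nat.cast_sub (by omega)]; push_cast; linarith
  have h2 : ((N + 1 - t : ℕ) : ℝ) ^ t ≤ (t.factorial : ℝ) * N.choose t := by
    exact_mod_cast (Nat.pow_sub_le_descFactorial N t).trans_eq
      (Nat.descFactorial_eq_factorial_mul_choose N t)
  rw [div_mul_eq_mul_div, div_le_iff₀ (by positivity)]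
  linarith

lemma choose_mul_ge {d t : ℕ} (hd : 0 < d) (ht : t ≤ d) (hdN : d * d + d ≤ 2 ^ (d - 1)) :
    (1 / 2 : ℝ) ^ t / t.factorial * (1 - (2 * (d : ℝ) ^ 2 + 1) / 2 ^ d) * 2 ^ 2 ^ (d - 1) ≤
      (((2 ^ (d - 1)).choose t * (2 ^ (2 ^ (d - 1) - t * d) - 1) : ℕ) : ℝ) := by
  have htd : t * d ≤ d * d := Nat.mul_le_mul_right d ht
  have hdd : d ≤ d * d := Nat.le_mul_of_pos_left d hd
  have hNpos : 0 < 2 ^ (d - 1) := by positivity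
  have h2d : (2 : ℝ) ^ d = 2 * 2 ^ (d - 1) := by
    rw [← pow_succ', Nat.sub_add_cancel hd]
  have hchoose := pow_mul_one_sub_le_choose (N := 2 ^ (d - 1)) (t := t) hNpos (by omega)
  obtain ⟨m, hm⟩ : ∃ m, 2 ^ (d - 1) = t * d + (d + m) := ⟨2 ^ (d - 1) - t * d - d, by omega⟩
  have hsub : 2 ^ (d - 1) - t * d = d + m := by omega
  have hpow : (2 : ℝ) ^ 2 ^ (d - 1) = (2 ^ d) ^ t * 2 ^ (d + m) := by
    rw [hm, pow_add, mul_comm t d, pow_mul]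
  rw [hsub, hpow]
  have hdm : (2 : ℝ) ^ (d + m) * (1 - 1 / 2 ^ d) ≤ 2 ^ (d + m) - 1 := by
    have : (1 : ℝ) ≤ 2 ^ (d + m) * (1 / 2 ^ d) := by
      rw [pow_add]
      have := one_le_pow₀ (M₀ := ℝ) (a := 2) one_le_two (n := m)
      field_simp
      exact this
    linarith
  push_cast [Nat.one_le_two_pow] at hchoose ⊢
  set N : ℝ := 2 ^ (d - 1) with hN
  have hN0 : 0 < N := by positivity
  have ht2 : (t : ℝ) ^ 2 ≤ (d : ℝ) ^ 2 := by gcongr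
  have hd1 : (0 : ℝ) ≤ 1 - 1 / 2 ^ d := by
    rw [sub_nonneg, div_le_one (by positivity)]
    exact one_le_pow₀ one_le_two
  have hmix : 1 - (2 * (d : ℝ) ^ 2 + 1) / 2 ^ d ≤ (1 - (t : ℝ) ^ 2 / N) * (1 - 1 / 2 ^ d) := by
    have e : (2 * (d : ℝ) ^ 2 + 1) / 2 ^ d = (d : ℝ) ^ 2 / N + 1 / 2 ^ d := by
      rw [h2d]; field_simp
    have h1 : (t : ℝ) ^ 2 / N ≤ (d : ℝ) ^ 2 / N := by gcongr
    have h2 : 0 ≤ (t : ℝ) ^ 2 / N * (1 / 2 ^ d) := by positivity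
    rw [e]; nlinarith
  calc (1 / 2 : ℝ) ^ t / t.factorial * (1 - (2 * (d : ℝ) ^ 2 + 1) / 2 ^ d) *
        ((2 ^ d) ^ t * 2 ^ (d + m))
      = N ^ t / t.factorial * (1 - (2 * (d : ℝ) ^ 2 + 1) / 2 ^ d) * 2 ^ (d + m) := by
        rw [h2d, mul_pow, div_pow]; field_simp; simp
    _ ≤ N ^ t / t.factorial * ((1 - (t : ℝ) ^ 2 / N) * (1 - 1 / 2 ^ d)) * 2 ^ (d + m) := by
        gcongr
    _ = (N ^ t / t.factorial * (1 - (t : ℝ) ^ 2 / N)) * (2 ^ (d + m) * (1 - 1 / 2 ^ d)) := by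
        ring
    _ ≤ _ := by
        gcongr

lemma exp_half_sub_le_sum (d : ℕ) :
    Real.exp (1 / 2) - 1 - 1 / 2 ^ d ≤
      ∑ t ∈ Icc 1 d, (1 / 2 : ℝ) ^ t / t.factorial := by
  have h := (abs_le.1 (Real.exp_bound (x := 1 / 2) (by rw [abs_of_pos] <;> norm_num)
    (Nat.succ_pos d))).2
  have hb : |(1 / 2 : ℝ)| ^ d.succ * ((d.succ.succ : ℝ) / (d.succ.factorial * d.succ)) ≤
      1 / 2 ^ d := by
    rw [abs_of_pos (by norm_num : (0 : ℝ) < 1 / 2), pow_succ, one_div_pow]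
    have hf : (1 : ℝ) ≤ d.succ.factorial := by exact_mod_cast d.succ.factorial_pos
    have : ((d.succ.succ : ℝ) / (d.succ.factorial * d.succ)) ≤ 2 := by
      rw [div_le_iff₀ (by positivity)]
      push_cast
      have : (0 : ℝ) ≤ d := by positivity
      nlinarith
    calc 1 / 2 ^ d * (1 / 2) * ((d.succ.succ : ℝ) / (d.succ.factorial * d.succ))
        ≤ 1 / 2 ^ d * (1 / 2) * 2 := by gcongr
      _ = 1 / 2 ^ d := by ring
  have hs : ∑ t ∈ range d.succ, (1 / 2 : ℝ) ^ t / t.factorial =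
      1 + ∑ t ∈ Icc 1 d, (1 / 2 : ℝ) ^ t / t.factorial := by
    rw [sum_range_succ', add_comm, range_eq_Ico, sum_Ico_add' (fun t : ℕ =>
      (1 / 2 : ℝ) ^ t / t.factorial) 0 d 1]
    simp only [pow_zero, Nat.factorial_zero, Nat.cast_one, div_one, zero_add]
    rfl
  rw [hs] at h
  linarith

lemma eventually_quadratic_lt_pow {r : ℝ} (hr : 1 < r) (C : ℝ) :
    ∀ᶠ d : ℕ in atTop, C * ((d : ℝ) ^ 2 + 1) < r ^ d := by
  have hr0 : 0 < r := by linarith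
  have habs : |r⁻¹| < 1 := by
    rw [abs_of_pos (inv_pos.2 hr0)]; exact inv_lt_one_of_one_lt₀ hr
  have h2 := tendsto_pow_const_mul_const_pow_of_abs_lt_one 2 habs
  have h0 := tendsto_pow_const_mul_const_pow_of_abs_lt_one 0 habs
  have h := (h2.add h0).const_mul C
  simp only [add_zero, mul_zero] at h
  filter_upwards [h.eventually_lt_const one_pos] with d hd
  have hp : 0 < r ^ d := by positivity
  rw [inv_pow] at hd
  have : C * ((d : ℝ) ^ 2 + 1) / r ^ d < 1 := by
    calc _ = C * ((d : ℝ) ^ 2 * (r ^ d)⁻¹ + (d : ℝ) ^ 0 * (r ^ d)⁻¹) := by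
          rw [pow_zero]; ring
      _ < 1 := hd
  rwa [div_lt_one hp] at this

theorem lower_bound_FE4 (α : ℝ) (hα1 : 1 < α) (hα2 : α < 2) :
    ∃ c > (0:ℝ), ∃ d₀ : ℕ, ∀ d : ℕ, d₀ ≤ d →
      (2 * Real.sqrt (Real.exp 1) - 2 - Real.exp (-c * d)) * 2 ^ 2 ^ (d - 1) ≤
        ((FEi d α 4).ncard : ℝ) := by
  have hc : 0 < -Real.log (3 / 4) := neg_pos.2 (Real.log_neg (by norm_num) (by norm_num))
  refine ⟨-Real.log (3 / 4), hc, ?_⟩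
  have e1 := eventually_quadratic_lt_pow hα1 1
  have e2 := eventually_quadratic_lt_pow (r := 2) one_lt_two 4
  have e3 := eventually_quadratic_lt_pow (r := 3 / 2) (by norm_num) 4
  have e4 := eventually_quadratic_lt_pow (r := 2 / α) ((one_lt_div (by linarith)).2 hα2) 2
  obtain ⟨d₀, hd₀⟩ := eventually_atTop.1
    (e1.and (e2.and (e3.and (e4.and (eventually_ge_atTop 1)))))
  refine ⟨d₀, fun d hdd => ?_⟩
  obtain ⟨h1, h2, h3, h4, hd⟩ := hd₀ d hdd
  have hd' : (1 : ℝ) ≤ d := by exact_mod_cast hd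
  have h2d : (2 : ℝ) ^ d = 2 * 2 ^ (d - 1) := by
    rw [← pow_succ', Nat.sub_add_cancel hd]
  have hdN : d * d + d ≤ 2 ^ (d - 1) := by
    have : (d : ℝ) * d + d ≤ 2 ^ (d - 1) := by nlinarith
    exact_mod_cast this
  have hα : (d : ℝ) < α ^ d := by nlinarith
  have hα' : α ^ d ≤ 2 ^ (d - 1) := by
    rw [div_pow, lt_div_iff₀ (by positivity)] at h4
    have : 0 < α ^ d := by positivity
    nlinarith
  have hcount := sum_choose_le_ncard_FEi hd (by nlinarith) hα hα'
  have hcount' : (2 : ℝ) * ∑ t ∈ Icc 1 d,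
      (((2 ^ (d - 1)).choose t * (2 ^ (2 ^ (d - 1) - t * d) - 1) : ℕ) : ℝ) ≤
      ((FEi d α 4).ncard : ℝ) := by
    exact_mod_cast hcount
  refine le_trans ?_ hcount'
  refine le_trans ?_ (mul_le_mul_of_nonneg_left
    (sum_le_sum fun t ht => choose_mul_ge hd (mem_Icc.1 ht).2 hdN) zero_le_two)
  rw [← sum_mul, ← sum_mul, ← mul_assoc]
  refine mul_le_mul_of_nonneg_right ?_ (by positivity)
  have hsum := exp_half_sub_le_sum d
  set X := ∑ t ∈ Icc 1 d, (1 / 2 : ℝ) ^ t / t.factorial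
  have hsqrt : Real.sqrt (Real.exp 1) = Real.exp (1 / 2) := (Real.exp_half 1).symm
  have hs2 : Real.exp (1 / 2) ≤ 2 := by
    rw [← hsqrt]
    refine Real.sqrt_le_iff.2 ⟨by norm_num, ?_⟩
    linarith [Real.exp_one_lt_d9]
  have hexp : Real.exp (-(-Real.log (3 / 4)) * d) = (3 / 4) ^ d := by
    rw [neg_neg, mul_comm, Real.exp_nat_mul, Real.exp_log (by norm_num)]
  rw [hsqrt, hexp]
  have hp : (0 : ℝ) < 2 ^ d := by positivity
  have herr : (4 * (d : ℝ) ^ 2 + 4) / 2 ^ d ≤ (3 / 4) ^ d := by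
    rw [div_le_iff₀ hp, ← mul_pow]
    norm_num at h3 ⊢
    linarith
  set q := (2 * (d : ℝ) ^ 2 + 1) / 2 ^ d with hq
  have hq0 : 0 ≤ q := by positivity
  have hq1 : q ≤ 1 := (div_le_one hp).2 (by nlinarith)
  have hi : (0 : ℝ) ≤ 1 / 2 ^ d := by positivity
  have hsplit : (4 * (d : ℝ) ^ 2 + 4) / 2 ^ d = 2 * q + 2 * (1 / 2 ^ d) := by
    rw [hq]; ring
  nlinarith [mul_le_mul_of_nonneg_right hsum (sub_nonneg.2 hq1), mul_nonneg hi hq0,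
    mul_nonneg (sub_nonneg.2 hs2) hq0]
end

section
/- For every real number α with 1 < α < 2 there exist constants c > 0 and d₀ such that for all integers d ≥ d₀: the number of f ∈ F for which there exist integers c₁ and c₂ with |{v ∈ E : f(v) ≠ c₁}| < α^d and |{v ∈ O : f(v) ≠ c₂}| < α^d is at most e^{−cd}·|F|. -/
/-- The set of homomorphisms from `Q_d` to `ℤ` sending the all-zeros vertex to `0`. -/
def HomF (d : ℕ) : Set ((Fin d → Bool) → ℤ) :=
  {f | f (fun _ => false) = 0 ∧ ∀ u v, cubeAdj d u v → |f u - f v| = 1}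


/-- The numbers of ones of two vertices add up to their Hamming distance plus twice the number
of common ones. -/
theorem card_ones_add_card_ones {d : ℕ} (u v : Fin d → Bool) :
    (Finset.univ.filter fun i => u i = true).card + (Finset.univ.filter fun i => v i = true).card =
      (Finset.univ.filter fun i => u i ≠ v i).card +
        2 * (Finset.univ.filter fun i => u i = true ∧ v i = true).card := by
  simp only [Finset.card_filter, Finset.mul_sum, ← Finset.sum_add_distrib]
  refine Finset.sum_congr rfl fun i _ => ?_
  cases u i <;> cases v i <;> simp

theorem cubeAdj.mem_evenV_iff {d : ℕ} {u v : Fin d → Bool} (h : cubeAdj d u v) :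
    u ∈ evenV d ↔ v ∉ evenV d := by
  have key := card_ones_add_card_ones u v
  unfold cubeAdj at h
  simp only [evenV, Set.mem_ofPred_eq, Nat.even_iff]
  omega

theorem cubeAdj_update_not {d : ℕ} (v : Fin d → Bool) (i : Fin d) :
    cubeAdj d v (Function.update v i (!v i)) := by
  unfold cubeAdj
  rw [Finset.card_eq_one]
  refine ⟨i, ?_⟩
  ext j
  by_cases h : j = i
  · subst h; simp
  · simp [h]

theorem abs_le_card_ones_of_mem_HomF {d : ℕ} {f : (Fin d → Bool) → ℤ} (hf : f ∈ HomF d) (k : ℕ) :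
    ∀ v : Fin d → Bool, (Finset.univ.filter fun i => v i = true).card = k → |f v| ≤ k := by
  induction k with
  | zero =>
    intro v hv
    have : v = fun _ => false := by
      funext i
      have := Finset.filter_eq_empty_iff.1 (Finset.card_eq_zero.1 hv) (Finset.mem_univ i)
      simpa using this
    rw [this, hf.1]
    simp
  | succ k ih =>
    intro v hv
    obtain ⟨i, hi⟩ : (Finset.univ.filter fun i => v i = true).Nonempty :=
      Finset.card_pos.1 (by omega)
    have hvi : v i = true := by simpa using hi
    have hcard : (Finset.univ.filter fun j => Function.update v i (!v i) j = true).card = k := by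
      have : (Finset.univ.filter fun j => Function.update v i (!v i) j = true) =
          (Finset.univ.filter fun j => v j = true).erase i := by
        ext j
        by_cases h : j = i
        · subst h; simp [hvi]
        · simp [h]
      rw [this, Finset.card_erase_of_mem hi, hv]
      rfl
    have h1 := ih _ hcard
    have h2 := hf.2 _ _ (cubeAdj_update_not v i)
    rw [abs_le] at h1 ⊢
    have h3 := abs_le.1 h2.le
    push_cast
    constructor <;> linarith [h1.1, h1.2, h3.1, h3.2]

theorem mem_Icc_of_mem_HomF {d : ℕ} {f : (Fin d → Bool) → ℤ} (hf : f ∈ HomF d)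
    (v : Fin d → Bool) : f v ∈ Finset.Icc (-d : ℤ) d := by
  have h1 := abs_le_card_ones_of_mem_HomF hf _ v rfl
  have h2 : (Finset.univ.filter fun i => v i = true).card ≤ d := by
    simpa using Finset.card_filter_le (Finset.univ : Finset (Fin d)) fun i => v i = true
  rw [Finset.mem_Icc, ← abs_le]
  exact h1.trans (by exact_mod_cast h2)

theorem HomF_finite (d : ℕ) : (HomF d).Finite :=
  (Set.Finite.pi' fun _ : Fin d → Bool => (Finset.Icc (-d : ℤ) d).finite_toSet).subset
    fun _ hf v => mem_Icc_of_mem_HomF hf v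

theorem two_pow_two_pow_le_ncard_HomF (n : ℕ) : 2 ^ 2 ^ n ≤ (HomF (n + 1)).ncard := by
  classical
  let F : ((Fin n → Bool) → Bool) → (Fin (n + 1) → Bool) → ℤ := fun g v =>
    if v ∈ evenV (n + 1) then 0 else if g (Fin.tail v) then 1 else -1
  have hF : Function.Injective F := by
    intro g g' h
    funext w
    obtain ⟨b, hb⟩ : ∃ b : Bool, (Fin.cons b w : Fin (n + 1) → Bool) ∉ evenV (n + 1) := by
      by_cases h0 : (Fin.cons false w : Fin (n + 1) → Bool) ∈ evenV (n + 1)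
      · refine ⟨true, ?_⟩
        have hadj := cubeAdj_update_not (Fin.cons false w : Fin (n + 1) → Bool) 0
        rw [Fin.update_cons_zero] at hadj
        exact hadj.mem_evenV_iff.1 h0
      · exact ⟨false, h0⟩
    have := congrFun h (Fin.cons b w)
    simp only [F, hb, if_false, Fin.tail_cons] at this
    revert this
    cases g w <;> cases g' w <;> simp
  have hsub : Set.range F ⊆ HomF (n + 1) := by
    rintro _ ⟨g, rfl⟩
    refine ⟨by simp [F, evenV], fun u v huv => ?_⟩
    have h := huv.mem_evenV_iff
    by_cases hu : u ∈ evenV (n + 1)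
    · have hv := h.1 hu
      by_cases hg : g (Fin.tail v) <;> simp [F, hu, hv, hg]
    · have hv : v ∈ evenV (n + 1) := by
        by_contra hv
        exact hu (h.2 hv)
      by_cases hg : g (Fin.tail u) <;> simp [F, hu, hv, hg]
  calc 2 ^ 2 ^ n = (Set.range F).ncard := by
        rw [← Set.image_univ, Set.ncard_image_of_injective _ hF, Set.ncard_univ]
        simp
    _ ≤ _ := Set.ncard_le_ncard hsub (HomF_finite _)

/-- The function that takes the values listed in `p.2.2` at the vertices listed there, `p.1` at the
remaining even vertices and `p.2.1` at the remaining odd vertices. -/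
noncomputable def nearConstant (d N : ℕ) (p : Finset.Icc (-d : ℤ) d × Finset.Icc (-d : ℤ) d ×
    (Fin N → (Fin d → Bool) × Finset.Icc (-d : ℤ) d)) (v : Fin d → Bool) : ℤ :=
  open Classical in
  if h : ∃ i, (p.2.2 i).1 = v then (p.2.2 h.choose).2
  else if v ∈ evenV d then p.1 else p.2.1

theorem ncard_range_nearConstant_le (d N : ℕ) :
    (Set.range (nearConstant d N)).ncard ≤
      (2 * d + 1) * ((2 * d + 1) * (2 ^ d * (2 * d + 1)) ^ N) := by
  rw [← Set.image_univ]
  refine (Set.ncard_image_le Set.finite_univ).trans ?_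
  rw [Set.ncard_univ, Nat.card_eq_fintype_card]
  simp only [Fintype.card_prod, Fintype.card_fun, Fintype.card_coe, Int.card_Icc, Fintype.card_fin,
    Fintype.card_bool]
  rw [show ((d : ℤ) + 1 - -d).toNat = 2 * d + 1 by omega]

/-- Replacing a constant by one in the range of values does not create new exceptions. -/
theorem exists_mem_Icc_exceptions_subset {d : ℕ} {f : (Fin d → Bool) → ℤ} (hf : f ∈ HomF d)
    (c : ℤ) : ∃ c' : Finset.Icc (-d : ℤ) d, ∀ v, f v ≠ c' → f v ≠ c := by
  by_cases hc : c ∈ Finset.Icc (-d : ℤ) d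
  · exact ⟨⟨c, hc⟩, fun v h => h⟩
  · refine ⟨⟨0, by simp⟩, fun v _ h => hc (h ▸ mem_Icc_of_mem_HomF hf v)⟩

theorem mem_range_nearConstant {d N : ℕ} {f : (Fin d → Bool) → ℤ} (hf : f ∈ HomF d) (c₁ c₂ : ℤ)
    (hN : ({v ∈ evenV d | f v ≠ c₁} : Set _).ncard + ({v ∈ oddV d | f v ≠ c₂} : Set _).ncard ≤ N) :
    f ∈ Set.range (nearConstant d N) := by
  classical
  obtain ⟨a₁, h₁⟩ := exists_mem_Icc_exceptions_subset hf c₁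
  obtain ⟨a₂, h₂⟩ := exists_mem_Icc_exceptions_subset hf c₂
  set A : Set (Fin d → Bool) := {v ∈ evenV d | f v ≠ c₁} ∪ {v ∈ oddV d | f v ≠ c₂} with hA
  have hcard : Fintype.card A ≤ Fintype.card (Fin N) := by
    rw [Fintype.card_fin, ← Nat.card_eq_fintype_card, Nat.card_coe_set_eq]
    exact (Set.ncard_union_le _ _).trans hN
  obtain ⟨e⟩ := Function.Embedding.nonempty_of_card_le hcard
  let h : Fin N → (Fin d → Bool) := Function.extend e Subtype.val fun _ _ => false
  have hh (a : A) : h (e a) = a := e.injective.extend_apply _ _ a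
  refine ⟨(a₁, a₂, fun i => (h i, ⟨f (h i), mem_Icc_of_mem_HomF hf _⟩)), ?_⟩
  funext v
  unfold nearConstant
  split_ifs with hv hev
  · exact congrArg f hv.choose_spec
  · by_contra hne
    have hvA : v ∈ A := Or.inl ⟨hev, h₁ v (Ne.symm hne)⟩
    exact hv ⟨e ⟨v, hvA⟩, hh ⟨v, hvA⟩⟩
  · by_contra hne
    have hvA : v ∈ A := Or.inr ⟨hev, h₂ v (Ne.symm hne)⟩
    exact hv ⟨e ⟨v, hvA⟩, hh ⟨v, hvA⟩⟩

theorem exists_forall_mul_pow_le_two_pow {α : ℝ} (hα1 : 1 < α) (hα2 : α < 2) (C : ℝ) (hC : 0 < C) :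
    ∃ d₀ : ℕ, ∀ d : ℕ, d₀ ≤ d → C * d * α ^ d ≤ 2 ^ d := by
  have h := tendsto_self_mul_const_pow_of_lt_one (r := α / 2) (by linarith) (by linarith)
  obtain ⟨d₀, hd₀⟩ := Filter.eventually_atTop.1 (h.eventually_le_const (inv_pos.2 hC))
  refine ⟨d₀, fun d hd => ?_⟩
  have h1 := hd₀ d hd
  rw [div_pow, ← mul_div_assoc, div_le_iff₀ (by positivity), ← div_eq_inv_mul,
    le_div_iff₀ hC] at h1
  linarith

theorem mostly_constant_both_sides_negligible (α : ℝ) (hα1 : 1 < α) (hα2 : α < 2) :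
    ∃ c > (0:ℝ), ∃ d₀ : ℕ, ∀ d : ℕ, d₀ ≤ d →
      (({f ∈ HomF d | ∃ c₁ c₂ : ℤ,
          (({v ∈ evenV d | f v ≠ c₁} : Set _).ncard : ℝ) < α ^ d ∧
          (({v ∈ oddV d | f v ≠ c₂} : Set _).ncard : ℝ) < α ^ d} : Set _).ncard : ℝ) ≤
        Real.exp (-c * d) * (HomF d).ncard := by
  obtain ⟨d₁, hd₁⟩ := exists_forall_mul_pow_le_two_pow hα1 hα2 22 (by norm_num)
  refine ⟨Real.log 2, Real.log_pos (by norm_num), d₁ + 1, fun d hd => ?_⟩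
  obtain ⟨n, rfl⟩ : ∃ n, d = n + 1 := ⟨d - 1, by omega⟩
  set d := n + 1 with hdn
  set N := ⌊2 * α ^ d⌋₊
  have hpow : (1 : ℝ) ≤ α ^ d := one_le_pow₀ hα1.le
  have hN : (N : ℝ) ≤ 2 * α ^ d := Nat.floor_le (by positivity)
  have hexp : Real.exp (-Real.log 2 * d) = (2 ^ d : ℝ)⁻¹ := by
    rw [neg_mul, Real.exp_neg, mul_comm, Real.exp_nat_mul, Real.exp_log (by norm_num)]
  have hcount : d + (4 * d + 3 * d * N) ≤ 2 ^ n := by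
    have h1 := hd₁ d (by omega)
    have hd0 : (0 : ℝ) ≤ d := by positivity
    have h2 : (d : ℝ) * N ≤ d * (2 * α ^ d) := mul_le_mul_of_nonneg_left hN hd0
    have h3 : (d : ℝ) * 1 ≤ d * α ^ d := mul_le_mul_of_nonneg_left hpow hd0
    have h4 : (2 : ℝ) ^ d = 2 * 2 ^ n := by rw [hdn, pow_succ]; ring
    have : ((d + (4 * d + 3 * d * N) : ℕ) : ℝ) ≤ ((2 ^ n : ℕ) : ℝ) := by
      push_cast
      linarith
    exact_mod_cast this
  have hsmall : 2 * d + 1 ≤ 2 ^ (2 * d) := by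
    have := Nat.lt_two_pow_self (n := 2 * d)
    omega
  have hbound : (2 * d + 1) * ((2 * d + 1) * (2 ^ d * (2 * d + 1)) ^ N) ≤
      2 ^ (4 * d + 3 * d * N) := by
    calc (2 * d + 1) * ((2 * d + 1) * (2 ^ d * (2 * d + 1)) ^ N)
        ≤ 2 ^ (2 * d) * (2 ^ (2 * d) * (2 ^ d * 2 ^ (2 * d)) ^ N) := by gcongr
      _ = 2 ^ (4 * d + 3 * d * N) := by
        rw [← pow_add, ← pow_mul, ← pow_add, ← pow_add]
        congr 1
        ring
  have hsub : {f ∈ HomF d | ∃ c₁ c₂ : ℤ,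
      (({v ∈ evenV d | f v ≠ c₁} : Set _).ncard : ℝ) < α ^ d ∧
      (({v ∈ oddV d | f v ≠ c₂} : Set _).ncard : ℝ) < α ^ d} ⊆ Set.range (nearConstant d N) := by
    rintro f ⟨hf, c₁, c₂, h₁, h₂⟩
    refine mem_range_nearConstant hf c₁ c₂ (Nat.le_floor ?_)
    push_cast
    linarith
  have hle := ((Set.ncard_le_ncard hsub (Set.finite_range _)).trans
    (ncard_range_nearConstant_le d N)).trans hbound
  rw [hexp, inv_mul_eq_div, le_div_iff₀ (by positivity)]
  have hfinal := calc
    _ ≤ 2 ^ (4 * d + 3 * d * N) * 2 ^ d := Nat.mul_le_mul_right (2 ^ d) hle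
    _ = 2 ^ (d + (4 * d + 3 * d * N)) := by rw [← pow_add, add_comm]
    _ ≤ 2 ^ 2 ^ n := Nat.pow_le_pow_right (by norm_num) hcount
    _ ≤ (HomF d).ncard := two_pow_two_pow_le_ncard_HomF n
  exact_mod_cast hfinal
end
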